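/- arXiv:1509.01371 — 4 statements merged into one kernel-verified Lean document; each statement's English description precedes it below -/
import Mathlib

section
/- Let m be odd. Then #{a ∈ F_r^* : η(a) = 1 and η̄(Tr(a^{-1})) = 1} = (p−1)·(p^{m-1} + (-1)^{((p-1)/2)·((m-1)/2)} p^{(m-1)/2})/4 and #{a ∈ F_r^* : η(a) = 1 and η̄(Tr(a^{-1})) = -1} = (p−1)·(p^{m-1} − (-1)^{((p-1)/2)·((m-1)/2)} p^{(m-1)/2})/4. -/
open Finset in
/-- The sum of `e (y ^ 2)` over a finite field is the quadratic Gauss sum of `e`. -/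
theorem sum_addChar_sq_eq_gaussSum {K : Type*} [Field K] [Fintype K] [DecidableEq K]
    (hK : ringChar K ≠ 2) {e : AddChar K ℂ} (he : e ≠ 1) :
    ∑ y, e (y ^ 2) = gaussSum ((quadraticChar K).ringHomComp (Int.castRingHom ℂ)) e := by
  rw [← sum_fiberwise univ (fun y : K ↦ y ^ 2)]
  have hfib (a : K) : ∑ y with y ^ 2 = a, e (y ^ 2) = ((quadraticChar K a : ℂ) + 1) * e a := by
    rw [sum_congr rfl fun y hy ↦ by rw [(mem_filter.mp hy).2], sum_const, nsmul_eq_mul]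
    congr 1
    have h := quadraticChar_card_sqrts hK a
    rw [Set.toFinset_ofPred] at h
    exact_mod_cast congrArg (Int.cast : ℤ → ℂ) h
  simp only [hfib, add_mul, one_mul, sum_add_distrib, AddChar.sum_eq_zero_of_ne_one he, add_zero]
  simp [gaussSum]

/-- Shifting the additive character of a quadratic Gauss sum by `w` multiplies the sum by the
quadratic character of `w`. -/
theorem gaussSum_quadraticChar_mulShift {K : Type*} [Field K] [Fintype K] [DecidableEq K]
    (hK : ringChar K ≠ 2) (e : AddChar K ℂ) (w : K) :
    gaussSum ((quadraticChar K).ringHomComp (Int.castRingHom ℂ)) (e.mulShift w) =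
      quadraticChar K w * gaussSum ((quadraticChar K).ringHomComp (Int.castRingHom ℂ)) e := by
  have hχ : ((quadraticChar K).ringHomComp (Int.castRingHom ℂ)).IsQuadratic :=
    (quadraticChar_isQuadratic K).comp _
  rcases eq_or_ne w 0 with rfl | hw
  · rw [AddChar.mulShift_zero, gaussSum_one_right]
    · simp
    · exact (MulChar.ringHomComp_ne_one_iff (RingHom.injective_int _)).mpr
        (quadraticChar_ne_one hK)
  · simpa [hχ.inv] using
      gaussSum_mulShift_eq ((quadraticChar K).ringHomComp (Int.castRingHom ℂ)) e (Units.mk0 w hw)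

/-- The discriminant of a Galois extension of odd degree is a square. -/
theorem isSquare_discr_of_odd_finrank {K L ι : Type*} [Field K] [Field L] [Algebra K L]
    [FiniteDimensional K L] [IsGalois K L] [Fintype ι] [DecidableEq ι] (b : Module.Basis ι K L)
    (hodd : Odd (Module.finrank K L)) : IsSquare (Algebra.discr K b) := by
  have hcard : Fintype.card ι = Fintype.card Gal(L/K) := by
    rw [← Module.finrank_eq_card_basis b, ← IsGalois.card_aut_eq_finrank K L,
      Nat.card_eq_fintype_card]
  let σ : ι ≃ Gal(L/K) := Fintype.equivOfCardEq hcard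
  let M : Matrix ι ι L := Matrix.of fun i j ↦ σ j (b i)
  have hM : (Algebra.traceMatrix K b).map (algebraMap K L) = M * M.transpose := by
    ext i j
    rw [Matrix.map_apply, Algebra.traceMatrix_apply, Algebra.traceForm_apply,
      trace_eq_sum_automorphisms, Matrix.mul_apply, ← Equiv.sum_comp σ]
    simp [M]
  have hdet : algebraMap K L (Algebra.discr K b) = M.det * M.det := by
    rw [Algebra.discr_def, RingHom.map_det, RingHom.mapMatrix_apply, hM, Matrix.det_mul,
      Matrix.det_transpose]
  have hfix (g : Gal(L/K)) : g M.det = M.det := by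
    let π : Equiv.Perm ι := σ.symm.permCongr (MulAction.toPerm g)
    have hπ : π ^ Module.finrank K L = 1 := by
      have h : (MulAction.toPermHom Gal(L/K) Gal(L/K) g) ^ Module.finrank K L = 1 := by
        rw [← map_pow, ← IsGalois.card_aut_eq_finrank K L, pow_card_eq_one', map_one]
      have := congrArg σ.symm.permCongrHom h
      rwa [map_pow, map_one] at this
    have hsign : Equiv.Perm.sign π = 1 := by
      rcases Int.units_eq_one_or (Equiv.Perm.sign π) with h | h
      · exact h
      · have h' := congrArg Equiv.Perm.sign hπ
        rw [map_pow, h, map_one, hodd.neg_one_pow] at h'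
        exact absurd h' (by decide)
    have hgM : (g : L →+* L).mapMatrix M = M.submatrix id π := by
      ext i j
      simp [M, π, Equiv.permCongr_apply]
    calc g M.det = ((g : L →+* L).mapMatrix M).det := RingHom.map_det (g : L →+* L) M
      _ = M.det := by rw [hgM, Matrix.det_permute', hsign]; simp
  obtain ⟨d, hd⟩ := (IsGalois.mem_range_algebraMap_iff_fixed M.det).mpr hfix
  exact ⟨d, (algebraMap K L).injective (by rw [hdet, map_mul, hd])⟩

/-- The Davenport–Hasse relation for quadratic Gauss sums in extensions of odd degree. -/
theorem gaussSum_quadraticChar_trace_of_odd_finrank {K L : Type*} [Field K] [Fintype K]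
    [DecidableEq K] [Field L] [Fintype L] [DecidableEq L] [Algebra K L] (hK : ringChar K ≠ 2)
    (hodd : Odd (Module.finrank K L)) {e : AddChar K ℂ} (he : e ≠ 1) :
    gaussSum ((quadraticChar L).ringHomComp (Int.castRingHom ℂ))
        (e.compAddMonoidHom (Algebra.trace K L).toAddMonoidHom) =
      gaussSum ((quadraticChar K).ringHomComp (Int.castRingHom ℂ)) e ^ Module.finrank K L := by
  have hL : ringChar L ≠ 2 := by rwa [← Algebra.ringChar_eq K L]
  have he' : e.compAddMonoidHom (Algebra.trace K L).toAddMonoidHom ≠ 1 := by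
    intro h
    refine he (DFunLike.ext _ _ fun t ↦ ?_)
    obtain ⟨x, rfl⟩ := Algebra.trace_surjective K L t
    simpa using DFunLike.congr_fun h x
  rw [← sum_addChar_sq_eq_gaussSum hL he']
  have : Invertible (2 : K) := invertibleOfNonzero (Ring.two_ne_zero hK)
  obtain ⟨b, hb⟩ := LinearMap.BilinForm.exists_orthogonal_basis
    (LinearMap.BilinForm.isSymm_iff.mp (Algebra.traceForm_isSymm K (S := L)))
  have hb' : ∀ i j, i ≠ j → Algebra.trace K L (b i * b j) = 0 := fun i j hij ↦ hb hij
  have hw i : Algebra.trace K L (b i * b i) ≠ 0 :=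
    hb.not_isOrtho_basis_self_of_separatingLeft (traceForm_nondegenerate K L).1 i
  have hdiscr : Algebra.discr K b = ∏ i, Algebra.trace K L (b i * b i) := by
    have : Algebra.traceMatrix K b = Matrix.diagonal fun i ↦ Algebra.trace K L (b i * b i) := by
      ext i j
      rw [Algebra.traceMatrix_apply, Algebra.traceForm_apply, Matrix.diagonal_apply]
      split_ifs with h
      · rw [h]
      · exact hb' i j h
    rw [Algebra.discr_def, this, Matrix.det_diagonal]
  have hquad : quadraticChar K (∏ i, Algebra.trace K L (b i * b i)) = 1 := by
    rw [quadraticChar_one_iff_isSquare (Finset.prod_ne_zero_iff.mpr fun i _ ↦ hw i), ← hdiscr]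
    exact isSquare_discr_of_odd_finrank b hodd
  have htr (c : Fin (Module.finrank K L) → K) : Algebra.trace K L ((∑ i, c i • b i) ^ 2) =
      ∑ i, Algebra.trace K L (b i * b i) * c i ^ 2 := by
    rw [sq, Finset.sum_mul_sum, map_sum]
    refine Finset.sum_congr rfl fun i _ ↦ ?_
    rw [map_sum, Finset.sum_eq_single i]
    · rw [smul_mul_smul_comm, map_smul, smul_eq_mul]; ring
    · intro j _ hj
      rw [smul_mul_smul_comm, map_smul, hb' i j hj.symm, smul_zero]
    · simp
  calc ∑ y : L, e.compAddMonoidHom (Algebra.trace K L).toAddMonoidHom (y ^ 2)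
      = ∑ c : Fin (Module.finrank K L) → K, ∏ i, e (Algebra.trace K L (b i * b i) * c i ^ 2) := by
        rw [← Equiv.sum_comp b.equivFun.symm.toEquiv]
        refine Finset.sum_congr rfl fun c _ ↦ ?_
        simp only [LinearEquiv.coe_toEquiv, Module.Basis.equivFun_symm_apply,
          AddChar.compAddMonoidHom_apply, LinearMap.toAddMonoidHom_coe, htr]
        exact map_prod e.toMonoidHom
          (fun i ↦ Multiplicative.ofAdd (Algebra.trace K L (b i * b i) * c i ^ 2)) Finset.univ
    _ = ∏ i, ∑ t : K, e (Algebra.trace K L (b i * b i) * t ^ 2) := by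
        rw [Finset.prod_univ_sum, Fintype.piFinset_univ]
    _ = ∏ i, quadraticChar K (Algebra.trace K L (b i * b i)) *
          gaussSum ((quadraticChar K).ringHomComp (Int.castRingHom ℂ)) e := by
        refine Finset.prod_congr rfl fun i _ ↦ ?_
        rw [← gaussSum_quadraticChar_mulShift hK,
          ← sum_addChar_sq_eq_gaussSum hK (AddChar.IsPrimitive.of_ne_one he (hw i))]
        simp
    _ = gaussSum ((quadraticChar K).ringHomComp (Int.castRingHom ℂ)) e ^ Module.finrank K L := by
        rw [Finset.prod_mul_distrib, Finset.prod_const, Finset.card_univ, Fintype.card_fin,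
          ← Int.cast_prod, ← map_prod, hquad, Int.cast_one, one_mul]

/-- In an extension of odd degree the quadratic character of the top field restricts to the
quadratic character of the base field. -/
theorem quadraticChar_algebraMap_of_odd_finrank {K L : Type*} [Field K] [Fintype K]
    [DecidableEq K] [Field L] [Fintype L] [DecidableEq L] [Algebra K L]
    (hodd : Odd (Module.finrank K L)) (c : K) :
    quadraticChar L (algebraMap K L c) = quadraticChar K c := by
  rcases eq_or_ne c 0 with rfl | hc
  · simp
  have hc' : algebraMap K L c ≠ 0 := by simpa using hc
  have hiff : quadraticChar L (algebraMap K L c) = 1 ↔ quadraticChar K c = 1 := by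
    rw [quadraticChar_one_iff_isSquare hc, quadraticChar_one_iff_isSquare hc']
    refine ⟨fun h ↦ ?_, fun h ↦ h.map _⟩
    have h' := h.map (Algebra.norm K)
    rw [Algebra.norm_algebraMap] at h'
    by_contra hns
    rw [← quadraticChar_one_iff_isSquare (pow_ne_zero _ hc), map_pow,
      quadraticChar_neg_one_iff_not_isSquare.mpr hns, hodd.neg_one_pow] at h'
    exact absurd h' (by decide)
  rcases quadraticChar_dichotomy hc with h | h <;>
    rcases quadraticChar_dichotomy hc' with h' | h' <;> simp_all

section CharacterSums

variable {K L : Type*} [Field K] [Fintype K] [DecidableEq K] [Field L] [Fintype L]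
  [Algebra K L]

/-- The number of elements of `L` of nonzero trace. -/
theorem sum_quadraticChar_trace_sq :
    ∑ x : L, quadraticChar K (Algebra.trace K L x) ^ 2 =
      ((Fintype.card K : ℤ) - 1) * (Fintype.card K : ℤ) ^ (Module.finrank K L - 1) := by
  have hker : Nat.card (LinearMap.ker (Algebra.trace K L)) =
      Fintype.card K ^ (Module.finrank K L - 1) := by
    rw [Module.natCard_eq_pow_finrank (K := K), Nat.card_eq_fintype_card]
    congr 1
    have h := (Algebra.trace K L).finrank_range_add_finrank_ker
    rw [LinearMap.range_eq_top.mpr (Algebra.trace_surjective K L), finrank_top,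
      Module.finrank_self] at h
    omega
  have hzero : ∑ x : L, (if Algebra.trace K L x = 0 then 1 else 0 : ℤ) =
      (Fintype.card K : ℤ) ^ (Module.finrank K L - 1) := by
    rw [← Nat.cast_pow, ← hker, Finset.sum_boole, ← Fintype.card_subtype, ← Nat.card_eq_fintype_card]
    rfl
  have hsq (t : K) : quadraticChar K t ^ 2 = 1 - if t = 0 then 1 else 0 := by
    split_ifs with h
    · simp [h]
    · rw [quadraticChar_sq_one h, sub_zero]
  simp only [hsq, Finset.sum_sub_distrib, hzero, Finset.sum_const, Finset.card_univ, nsmul_eq_mul,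
    mul_one]
  rw [Module.card_eq_pow_finrank (K := K) (V := L), Nat.cast_pow,
    ← Nat.sub_one_add_one (Module.finrank_pos (R := K) (M := L)).ne', pow_succ]
  simp only [Nat.add_sub_cancel]
  ring

/-- A sum over a field vanishes if scaling by some nonzero element negates each term. -/
theorem Fintype.sum_eq_zero_of_mul_left_neg {a : L} (ha : a ≠ 0) {f : L → ℤ}
    (hf : ∀ x, f (a * x) = -f x) : ∑ x, f x = 0 := by
  have h := Equiv.sum_comp (Equiv.mulLeft₀ a ha) f
  simp only [Equiv.mulLeft₀_apply, hf, Finset.sum_neg_distrib] at h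
  omega

variable [DecidableEq L]

/-- The correlation of the quadratic character of `L` with that of `K` composed with the trace. -/
theorem sum_quadraticChar_mul_quadraticChar_trace (hK : ringChar K ≠ 2)
    (hodd : Odd (Module.finrank K L)) :
    ∑ x : L, quadraticChar L x * quadraticChar K (Algebra.trace K L x) =
      ((Fintype.card K : ℤ) - 1) *
        (quadraticChar K (-1) * Fintype.card K) ^ ((Module.finrank K L - 1) / 2) := by
  obtain ⟨e, he⟩ : ∃ e : AddChar K ℂ, e ≠ 1 := by
    obtain ⟨e, he⟩ := AddChar.exists_apply_ne_zero.mpr (one_ne_zero (α := K))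
    exact ⟨e, fun h ↦ he (by simp [h])⟩
  set χ := (quadraticChar K).ringHomComp (Int.castRingHom ℂ) with hχ
  have hχ₁ : χ ≠ 1 :=
    (MulChar.ringHomComp_ne_one_iff (RingHom.injective_int _)).mpr (quadraticChar_ne_one hK)
  set g := gaussSum χ e with hg
  have hprim : e.IsPrimitive := .of_ne_one he
  have hg0 : g ≠ 0 := gaussSum_ne_zero_of_nontrivial (by simp) hχ₁ hprim
  have hg2 : g ^ 2 = (quadraticChar K (-1) : ℂ) * Fintype.card K :=
    gaussSum_sq hχ₁ ((quadraticChar_isQuadratic K).comp _) hprim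
  have key : ((∑ x : L, quadraticChar L x * quadraticChar K (Algebra.trace K L x) : ℤ) : ℂ) * g =
      ((Fintype.card K : ℂ) - 1) * g ^ Module.finrank K L := by
    calc _ = ∑ x : L, quadraticChar L x * gaussSum χ (e.mulShift (Algebra.trace K L x)) := by
          push_cast
          rw [Finset.sum_mul]
          refine Finset.sum_congr rfl fun x _ ↦ ?_
          rw [hχ, gaussSum_quadraticChar_mulShift hK, mul_assoc]
      _ = ∑ t : K, quadraticChar K t * gaussSum ((quadraticChar L).ringHomComp (Int.castRingHom ℂ))
            ((e.compAddMonoidHom (Algebra.trace K L).toAddMonoidHom).mulShift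
              (algebraMap K L t)) := by
          simp only [gaussSum, Finset.mul_sum]
          rw [Finset.sum_comm]
          refine Finset.sum_congr rfl fun t _ ↦ Finset.sum_congr rfl fun x _ ↦ ?_
          have : Algebra.trace K L (algebraMap K L t * x) = Algebra.trace K L x * t := by
            rw [← Algebra.smul_def, map_smul, smul_eq_mul, mul_comm]
          simp only [AddChar.mulShift_apply, AddChar.compAddMonoidHom_apply, hχ]
          simp only [LinearMap.toAddMonoidHom_coe, this, MulChar.ringHomComp_apply, eq_intCast]
          ring
      _ = ∑ t : K, ((quadraticChar K t ^ 2 : ℤ) : ℂ) * g ^ Module.finrank K L := by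
          refine Finset.sum_congr rfl fun t _ ↦ ?_
          rw [gaussSum_quadraticChar_mulShift (by rwa [← Algebra.ringChar_eq K L]),
            gaussSum_quadraticChar_trace_of_odd_finrank hK hodd he,
            quadraticChar_algebraMap_of_odd_finrank hodd]
          push_cast
          ring
      _ = _ := by
          have h := sum_quadraticChar_trace_sq (K := K) (L := K)
          simp only [Algebra.trace_self_apply, Module.finrank_self, Nat.sub_self, pow_zero,
            mul_one] at h
          rw [← Finset.sum_mul, ← Int.cast_sum, h]
          push_cast
          rfl
  obtain ⟨k, hk⟩ := hodd
  rw [hk, pow_succ, ← mul_assoc, pow_mul, hg2] at key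
  have := mul_right_cancel₀ hg0 key
  rw [hk, show (2 * k + 1 - 1) / 2 = k by omega]
  exact_mod_cast this

open Finset in
/-- The number of squares in an extension of odd degree whose trace has a given nonzero quadratic
character. -/
theorem four_mul_card_quadraticChar_trace_eq (hK : ringChar K ≠ 2)
    (hodd : Odd (Module.finrank K L)) {s : ℤ} (hs : s = 1 ∨ s = -1) :
    4 * (#{x : L | quadraticChar L x = 1 ∧ quadraticChar K (Algebra.trace K L x) = s} : ℤ) =
      ((Fintype.card K : ℤ) - 1) * ((Fintype.card K : ℤ) ^ (Module.finrank K L - 1) +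
        s * (quadraticChar K (-1) * Fintype.card K) ^ ((Module.finrank K L - 1) / 2)) := by
  have hind (x : L) :
      4 * (if quadraticChar L x = 1 ∧ quadraticChar K (Algebra.trace K L x) = s then 1 else 0) =
        quadraticChar K (Algebra.trace K L x) ^ 2 + s * quadraticChar K (Algebra.trace K L x) +
        quadraticChar L x * quadraticChar K (Algebra.trace K L x) ^ 2 +
        s * (quadraticChar L x * quadraticChar K (Algebra.trace K L x)) := by
    rcases eq_or_ne (Algebra.trace K L x) 0 with ht | ht
    · rcases hs with rfl | rfl <;> simp [ht]
    · have hx : x ≠ 0 := by rintro rfl; simp at ht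
      rcases quadraticChar_dichotomy ht with h | h <;>
        rcases quadraticChar_dichotomy hx with h' | h' <;>
        rcases hs with rfl | rfl <;> simp [h, h']
  obtain ⟨c, hc⟩ := quadraticChar_exists_neg_one hK
  have hc0 : algebraMap K L c ≠ 0 := by
    rintro h
    rw [(map_eq_zero _).mp h] at hc
    simp at hc
  have hcL : quadraticChar L (algebraMap K L c) = -1 := by
    rw [quadraticChar_algebraMap_of_odd_finrank hodd, hc]
  have hctr (x : L) : quadraticChar K (Algebra.trace K L (algebraMap K L c * x)) =
      -quadraticChar K (Algebra.trace K L x) := by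
    rw [← Algebra.smul_def, map_smul, smul_eq_mul, map_mul, hc, neg_one_mul]
  have h₁ : ∑ x : L, quadraticChar K (Algebra.trace K L x) = 0 :=
    Fintype.sum_eq_zero_of_mul_left_neg hc0 hctr
  have h₂ : ∑ x : L, quadraticChar L x * quadraticChar K (Algebra.trace K L x) ^ 2 = 0 :=
    Fintype.sum_eq_zero_of_mul_left_neg hc0 fun x ↦ by rw [hctr, map_mul, hcL]; ring
  rw [← sum_boole, mul_sum, sum_congr rfl fun x _ ↦ hind x]
  simp only [sum_add_distrib, ← mul_sum]
  rw [h₁, h₂, sum_quadraticChar_trace_sq, sum_quadraticChar_mul_quadraticChar_trace hK hodd]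
  ring

end CharacterSums


theorem stmt_11 (p m : ℕ) [Fact p.Prime] (hp2 : p ≠ 2) (hm : 2 ≤ m) (hmodd : Odd m)
    (F : Type) [Field F] [Fintype F] [DecidableEq F] [Algebra (ZMod p) F]
    (hcard : Fintype.card F = p ^ m) :
    4 * (({a : F | a ≠ 0 ∧ quadraticChar F a = 1 ∧
        quadraticChar (ZMod p) (Algebra.trace (ZMod p) F a⁻¹) = 1}).ncard : ℤ)
      = ((p : ℤ) - 1) * ((p : ℤ) ^ (m - 1)
          + (-1) ^ (((p - 1) / 2) * ((m - 1) / 2)) * (p : ℤ) ^ ((m - 1) / 2)) ∧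
    4 * (({a : F | a ≠ 0 ∧ quadraticChar F a = 1 ∧
        quadraticChar (ZMod p) (Algebra.trace (ZMod p) F a⁻¹) = -1}).ncard : ℤ)
      = ((p : ℤ) - 1) * ((p : ℤ) ^ (m - 1)
          - (-1) ^ (((p - 1) / 2) * ((m - 1) / 2)) * (p : ℤ) ^ ((m - 1) / 2)) := by
  have hp := (Fact.out : p.Prime)
  have hpodd : p % 2 = 1 := hp.eq_two_or_odd.resolve_left hp2
  have hK : ringChar (ZMod p) ≠ 2 := by rwa [ZMod.ringChar_zmod_n]
  have hfin : Module.finrank (ZMod p) F = m := by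
    have h := Module.card_eq_pow_finrank (K := ZMod p) (V := F)
    rw [ZMod.card, hcard] at h
    exact (Nat.pow_right_injective hp.two_le h).symm
  have hcount {s : ℤ} (hs : s = 1 ∨ s = -1) :
      4 * (({a : F | a ≠ 0 ∧ quadraticChar F a = 1 ∧
        quadraticChar (ZMod p) (Algebra.trace (ZMod p) F a⁻¹) = s}).ncard : ℤ)
      = ((p : ℤ) - 1) * ((p : ℤ) ^ (m - 1)
          + s * ((-1) ^ (((p - 1) / 2) * ((m - 1) / 2)) * (p : ℤ) ^ ((m - 1) / 2))) := by
    have hneg : quadraticChar (ZMod p) (-1) = (-1) ^ ((p - 1) / 2) := by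
      rw [quadraticChar_neg_one hK, ZMod.card, ZMod.χ₄_eq_neg_one_pow hpodd]
      congr 1
      omega
    have h := four_mul_card_quadraticChar_trace_eq (L := F) hK (hfin ▸ hmodd) hs
    rw [hfin, ZMod.card, hneg, mul_pow, ← pow_mul] at h
    rw [← h, ← Set.ncard_coe_finset]
    congr 2
    refine Set.ncard_congr (fun a _ ↦ a⁻¹) ?_ (fun a b _ _ hab ↦ inv_injective hab) ?_
    · rintro a ⟨-, ha, ht⟩
      rw [Finset.mem_coe, Finset.mem_filter_univ]
      refine ⟨?_, ht⟩
      rw [← Ring.inverse_eq_inv, ← MulChar.inv_apply, (quadraticChar_isQuadratic F).inv, ha]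
    · intro b hb
      rw [Finset.mem_coe, Finset.mem_filter_univ] at hb
      have hb0 : b ≠ 0 := by
        rintro rfl
        simp at hb
      refine ⟨b⁻¹, ⟨inv_ne_zero hb0, ?_, by rw [inv_inv]; exact hb.2⟩, inv_inv b⟩
      rw [← Ring.inverse_eq_inv, ← MulChar.inv_apply, (quadraticChar_isQuadratic F).inv, hb.1]
  exact ⟨by simpa using hcount (Or.inl rfl), by simpa [sub_eq_add_neg] using hcount (Or.inr rfl)⟩
end

section
/- Let m be even. Then #{a ∈ F_r^* : η(a)·η̄(Tr(a^{-1})) = 1} = #{a ∈ F_r^* : η(a)·η̄(Tr(a^{-1})) = -1} = (p^m − p^{m-1})/2. -/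
/-- Over a finite field of even degree over `ZMod p`, every scalar becomes a square. -/
theorem quadraticChar_algebraMap_eq_one_of_even {p m : ℕ} [Fact p.Prime] (hp2 : p ≠ 2)
    (hmeven : Even m) {F : Type*} [Field F] [Fintype F] [DecidableEq F] [Algebra (ZMod p) F]
    (hcard : Fintype.card F = p ^ m) {g : ZMod p} (hg : g ≠ 0) :
    quadraticChar F (algebraMap (ZMod p) F g) = 1 := by
  have hp : p.Prime := Fact.out
  have : CharP F p := charP_of_injective_algebraMap (algebraMap (ZMod p) F).injective p
  have hchar : ringChar F ≠ 2 := by rwa [ringChar.eq F p]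
  have hg' : algebraMap (ZMod p) F g ≠ 0 := by simpa using hg
  rw [quadraticChar_one_iff_isSquare hg', FiniteField.isSquare_iff hchar hg', hcard]
  obtain ⟨k, rfl⟩ := hmeven
  obtain ⟨n, hn⟩ : Odd (p ^ k) := (hp.odd_of_ne_two hp2).pow
  have hdvd : p - 1 ∣ 2 * n := by simpa [hn] using Nat.sub_dvd_pow_sub_pow p 1 k
  have hhalf : p ^ (k + k) / 2 = 2 * n * (n + 1) := by
    have : p ^ (k + k) = 2 * (2 * n * (n + 1)) + 1 := by rw [pow_add, hn]; ring
    omega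
  obtain ⟨c, hc⟩ := hdvd
  rw [hhalf, hc, mul_assoc, pow_mul, ← map_pow, ZMod.pow_card_sub_one_eq_one hg, map_one, one_pow]

/-- The number of elements of nonzero trace in a finite extension of `ZMod p`. -/
theorem ncard_trace_ne_zero {p m : ℕ} [Fact p.Prime] {F : Type*} [Field F] [Fintype F]
    [Algebra (ZMod p) F] (hcard : Fintype.card F = p ^ m) :
    {a : F | Algebra.trace (ZMod p) F a ≠ 0}.ncard = p ^ m - p ^ (m - 1) := by
  have hp : p.Prime := Fact.out
  have hfin : Module.finrank (ZMod p) F = m := by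
    have h := Module.card_eq_pow_finrank (K := ZMod p) (V := F)
    rw [hcard, ZMod.card] at h
    exact (Nat.pow_right_injective hp.two_le h).symm
  have hsurj := Algebra.trace_surjective (ZMod p) F
  have hrank := (Algebra.trace (ZMod p) F).finrank_range_add_finrank_ker
  rw [LinearMap.range_eq_top.mpr hsurj, finrank_top, Module.finrank_self, hfin] at hrank
  have hker : {a : F | Algebra.trace (ZMod p) F a = 0}.ncard = p ^ (m - 1) := by
    have h := Module.natCard_eq_pow_finrank (K := ZMod p)
      (V := LinearMap.ker (Algebra.trace (ZMod p) F))
    rw [Nat.card_zmod, show Module.finrank (ZMod p)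
      (LinearMap.ker (Algebra.trace (ZMod p) F)) = m - 1 by omega] at h
    exact h
  have h := Set.ncard_compl {a : F | Algebra.trace (ZMod p) F a = 0}
  rwa [hker, Nat.card_eq_fintype_card, hcard] at h

theorem stmt_12 (p m : ℕ) [Fact p.Prime] (hp2 : p ≠ 2) (hm : 2 ≤ m) (hmeven : Even m)
    (F : Type) [Field F] [Fintype F] [DecidableEq F] [Algebra (ZMod p) F]
    (hcard : Fintype.card F = p ^ m) :
    ({a : F | a ≠ 0 ∧
        quadraticChar F a * quadraticChar (ZMod p) (Algebra.trace (ZMod p) F a⁻¹) = 1}).ncard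
      = (p ^ m - p ^ (m - 1)) / 2 ∧
    ({a : F | a ≠ 0 ∧
        quadraticChar F a * quadraticChar (ZMod p) (Algebra.trace (ZMod p) F a⁻¹) = -1}).ncard
      = (p ^ m - p ^ (m - 1)) / 2 := by
  set f : F → ℤ := fun a ↦
    quadraticChar F a * quadraticChar (ZMod p) (Algebra.trace (ZMod p) F a⁻¹) with hf
  change {a : F | a ≠ 0 ∧ f a = 1}.ncard = _ ∧ {a : F | a ≠ 0 ∧ f a = -1}.ncard = _
  obtain ⟨g, hg⟩ := quadraticChar_exists_neg_one (F := ZMod p)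
    (by rwa [ringChar.eq (ZMod p) p])
  have hg0 : g ≠ 0 := by rintro rfl; simp at hg
  have hsq := quadraticChar_algebraMap_eq_one_of_even hp2 hmeven hcard (inv_ne_zero hg0)
  have hgF : algebraMap (ZMod p) F g⁻¹ ≠ 0 := by simpa using hg0
  have hflip (a : F) : f (algebraMap (ZMod p) F g⁻¹ * a) = -f a := by
    have hinv : (algebraMap (ZMod p) F g⁻¹ * a)⁻¹ = g • a⁻¹ := by
      rw [mul_inv, map_inv₀, inv_inv, Algebra.smul_def]
    simp only [hf]
    rw [hinv, map_mul, hsq, map_smul, smul_eq_mul, map_mul, hg]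
    ring
  have heq : {a : F | a ≠ 0 ∧ f a = 1}.ncard = {a : F | a ≠ 0 ∧ f a = -1}.ncard := by
    rw [← Set.ncard_preimage_of_injective_subset_range (mul_right_injective₀ hgF)
      (s := {a : F | a ≠ 0 ∧ f a = -1})
      (by rw [(mul_left_surjective₀ hgF).range_eq]; exact Set.subset_univ _)]
    congr 1
    ext a
    simp only [Set.mem_preimage, Set.mem_ofPred_eq, hflip, neg_inj, mul_ne_zero_iff_left hgF]
  have hunion : {a : F | a ≠ 0 ∧ f a = 1} ∪ {a : F | a ≠ 0 ∧ f a = -1} =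
      Inv.inv ⁻¹' {a : F | Algebra.trace (ZMod p) F a ≠ 0} := by
    ext a
    simp only [Set.mem_union, Set.mem_preimage, Set.mem_ofPred_eq]
    by_cases ha : a = 0
    · simp [ha]
    by_cases ht : Algebra.trace (ZMod p) F a⁻¹ = 0
    · simp [hf, ht]
    rcases quadraticChar_dichotomy ha with h1 | h1 <;>
      rcases quadraticChar_dichotomy ht with h2 | h2 <;>
        simp only [hf, h1, h2] <;> simp [ha, ht]
  have hdisj : Disjoint {a : F | a ≠ 0 ∧ f a = 1} {a : F | a ≠ 0 ∧ f a = -1} := by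
    rw [Set.disjoint_left]
    rintro a ⟨-, h1⟩ ⟨-, h2⟩
    omega
  have hsum := Set.ncard_union_eq hdisj
  rw [hunion, Set.ncard_preimage_of_injective_subset_range inv_injective
    (by rw [inv_surjective.range_eq]; exact Set.subset_univ _), ncard_trace_ne_zero hcard] at hsum
  omega
end

section
/- Let m be even. Then, with wt(a) = #{x ∈ F_r^* : Tr(x) = 0 and Tr(ax²) ≠ 0}: the number of a ∈ F_r^* with wt(a) = (p−1)p^{m-2} is p^m − p^{m-1}; the number of a ∈ F_r^* with wt(a) = (p−1)(p^{m-2} + p^{(m-2)/2}) is (1/2)(p^{m/2} + 1)(p^{(m-2)/2} − 1); and the number of a ∈ F_r^* with wt(a) = (p−1)(p^{m-2} − p^{(m-2)/2}) is (1/2)(p^{m/2} − 1)(p^{(m-2)/2} + 1). -/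
/-- The Hamming weight of the codeword of `C_D` indexed by `a`:
the number of `x ∈ D = {x ∈ F_r^* : Tr(x) = 0}` with `Tr(a x²) ≠ 0`. -/
noncomputable def codewordWeight (p : ℕ) (F : Type) [Field F] [Algebra (ZMod p) F]
    (a : F) : ℕ :=
  ({x : F | x ≠ 0 ∧ Algebra.trace (ZMod p) F x = 0 ∧
      Algebra.trace (ZMod p) F (a * x ^ 2) ≠ 0}).ncard

open Finset

section QuadraticSums

variable {F : Type} [Field F] [Fintype F] [DecidableEq F]

/-- The quadratic Gauss sum of a finite field with respect to an additive character. -/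
noncomputable def quadraticGaussSum (ψ : AddChar F ℂ) : ℂ :=
  gaussSum ((quadraticChar F).ringHomComp (Int.castRingHom ℂ)) ψ

theorem quadraticGaussSum_eq_sum (ψ : AddChar F ℂ) :
    quadraticGaussSum ψ = ∑ x, (quadraticChar F x : ℂ) * ψ x := by
  simp [quadraticGaussSum, gaussSum, MulChar.ringHomComp_apply]

theorem sum_addChar_sq (hF : ringChar F ≠ 2) {ψ : AddChar F ℂ} (hψ : ψ ≠ 1) :
    ∑ x, ψ (x ^ 2) = quadraticGaussSum ψ := by
  rw [quadraticGaussSum_eq_sum]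
  have h1 : ∑ x, ψ (x ^ 2) = ∑ t, (((quadraticChar F t + 1 : ℤ)) : ℂ) * ψ t := by
    rw [← Finset.sum_fiberwise univ (fun x : F => x ^ 2)]
    refine Finset.sum_congr rfl fun t _ => ?_
    rw [← quadraticChar_card_sqrts hF t, Finset.sum_congr rfl
      (g := fun _ => ψ t) (fun x hx => by rw [(Finset.mem_filter.mp hx).2])]
    simp
  rw [h1]
  simp [add_mul, Finset.sum_add_distrib, AddChar.sum_eq_zero_of_ne_one hψ]

theorem quadraticGaussSum_mulShift (ψ : AddChar F ℂ) {a : F} (ha : a ≠ 0) :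
    quadraticGaussSum (ψ.mulShift a) = quadraticChar F a * quadraticGaussSum ψ := by
  have h := gaussSum_mulShift ((quadraticChar F).ringHomComp (Int.castRingHom ℂ)) ψ
    (Units.mk0 a ha)
  simp only [Units.val_mk0, MulChar.ringHomComp_apply, eq_intCast] at h
  have h2 : ((quadraticChar F a : ℤ) : ℂ) * (quadraticChar F a : ℤ) = 1 := by
    rcases quadraticChar_dichotomy ha with h | h <;> simp [h]
  unfold quadraticGaussSum
  rw [← h, ← mul_assoc, h2, one_mul]

theorem quadraticGaussSum_sq (hF : ringChar F ≠ 2) {ψ : AddChar F ℂ} (hψ : ψ.IsPrimitive) :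
    quadraticGaussSum ψ ^ 2 = quadraticChar F (-1) * Fintype.card F := by
  have := gaussSum_sq (χ := (quadraticChar F).ringHomComp (Int.castRingHom ℂ))
    ((MulChar.ringHomComp_ne_one_iff (RingHom.injective_int _)).mpr (quadraticChar_ne_one hF))
    ((quadraticChar_isQuadratic F).comp _) hψ
  simpa [MulChar.ringHomComp_apply, quadraticGaussSum] using this

theorem sum_addChar_quadratic (hF : ringChar F ≠ 2) {ψ : AddChar F ℂ} (hψ : ψ.IsPrimitive)
    {a : F} (ha : a ≠ 0) (b : F) :
    ∑ x, ψ (a * x ^ 2 + b * x)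
      = ψ (-(b ^ 2 / (4 * a))) * (quadraticChar F a * quadraticGaussSum ψ) := by
  have h2 : (2 : F) ≠ 0 := Ring.two_ne_zero hF
  have h4 : (4 : F) ≠ 0 := by
    have : (4 : F) = 2 * 2 := by norm_num
    rw [this]
    exact mul_ne_zero h2 h2
  rw [← quadraticGaussSum_mulShift ψ ha, ← sum_addChar_sq hF (hψ ha), Finset.mul_sum,
    ← Equiv.sum_comp (Equiv.addRight (b / (2 * a)))
      (fun x => ψ (-(b ^ 2 / (4 * a))) * ψ.mulShift a (x ^ 2))]
  refine Finset.sum_congr rfl fun x _ => ?_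
  rw [AddChar.mulShift_apply, ← AddChar.map_add_eq_mul]
  congr 1
  simp only [Equiv.coe_addRight]
  field_simp
  ring

end QuadraticSums

section TraceCharacter

variable (p : ℕ) [Fact p.Prime] (F : Type) [Field F] [Algebra (ZMod p) F]

/-- The canonical additive character `x ↦ exp (2πi Tr(x) / p)`. -/
noncomputable def traceChar : AddChar F ℂ :=
  (ZMod.stdAddChar (N := p)).compAddMonoidHom (Algebra.trace (ZMod p) F).toAddMonoidHom

variable {F}

theorem traceChar_apply (x : F) :
    traceChar p F x = ZMod.stdAddChar (Algebra.trace (ZMod p) F x) := rfl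

theorem traceChar_algebraMap_mul (y : ZMod p) (x : F) :
    traceChar p F (algebraMap (ZMod p) F y * x)
      = ZMod.stdAddChar (y * Algebra.trace (ZMod p) F x) := by
  rw [traceChar_apply, ← Algebra.smul_def, map_smul, smul_eq_mul]

variable [Fintype F]

theorem isPrimitive_traceChar : (traceChar p F).IsPrimitive := by
  refine AddChar.IsPrimitive.of_ne_one fun h => ?_
  obtain ⟨x, hx⟩ := Algebra.trace_surjective (ZMod p) F 1
  have h1 := DFunLike.congr_fun h x
  rw [traceChar_apply, hx] at h1
  have := (ZMod.isPrimitive_stdAddChar p).zmod_char_eq_one_iff p (1 : ZMod p)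
  exact one_ne_zero (this.mp (by simpa using h1))

theorem sum_stdAddChar_mul (t : ZMod p) :
    ∑ y : ZMod p, (ZMod.stdAddChar (y * t) : ℂ) = if t = 0 then (p : ℂ) else 0 := by
  rw [AddChar.sum_mulShift t (ZMod.isPrimitive_stdAddChar p), ZMod.card]
  split_ifs <;> simp

theorem sum_traceChar_algebraMap_mul (y : ZMod p) :
    ∑ x : F, traceChar p F (algebraMap (ZMod p) F y * x)
      = if y = 0 then (Fintype.card F : ℂ) else 0 := by
  classical
  simp_rw [mul_comm (algebraMap (ZMod p) F y)]
  rw [AddChar.sum_mulShift _ (isPrimitive_traceChar p)]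
  simp

theorem card_trace_eq_zero_mul [DecidableEq F] :
    (#{x : F | Algebra.trace (ZMod p) F x = 0} : ℂ) * p = Fintype.card F := by
  have h : ∑ x : F, ∑ y : ZMod p, traceChar p F (algebraMap (ZMod p) F y * x)
      = Fintype.card F := by
    rw [Finset.sum_comm]
    simp [sum_traceChar_algebraMap_mul]
  simp_rw [traceChar_algebraMap_mul, sum_stdAddChar_mul] at h
  rw [← h, ← Finset.sum_filter, Finset.sum_const, nsmul_eq_mul]

variable {p}

theorem quadraticChar_algebraMap [DecidableEq F] {m : ℕ} (hF : ringChar F ≠ 2)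
    (hp2 : p ≠ 2) (hmeven : Even m) (hcard : Fintype.card F = p ^ m) {y : ZMod p} (hy : y ≠ 0) :
    quadraticChar F (algebraMap (ZMod p) F y) = 1 := by
  have hy' : algebraMap (ZMod p) F y ≠ 0 := by simpa using hy
  rw [quadraticChar_one_iff_isSquare hy', FiniteField.isSquare_iff hF hy', ← map_pow]
  suffices h : p - 1 ∣ Fintype.card F / 2 by
    obtain ⟨c, hc⟩ := h
    rw [hc, pow_mul, ZMod.pow_card_sub_one_eq_one hy, one_pow, map_one]
  obtain ⟨k, rfl⟩ := hmeven
  obtain ⟨l, hl⟩ := (Fact.out : p.Prime).odd_of_ne_two hp2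
  rw [hcard, ← two_mul, pow_mul]
  have h1 : p ^ 2 - 1 ∣ (p ^ 2) ^ k - 1 := by simpa using Nat.sub_dvd_pow_sub_pow (p ^ 2) 1 k
  obtain ⟨c, hc⟩ := h1
  have hpos : 0 < (p ^ 2) ^ k := by have := (Fact.out : p.Prime).pos; positivity
  have h2 : p ^ 2 - 1 = 2 * ((p - 1) * (l + 1)) := by
    subst hl
    have : (2 * l + 1) ^ 2 = 2 * (2 * l * (l + 1)) + 1 := by ring
    rw [this, Nat.add_sub_cancel, Nat.add_sub_cancel]
  have h3 : (p ^ 2) ^ k = 2 * ((p - 1) * (l + 1) * c) + 1 := by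
    rw [← mul_assoc 2, ← h2, ← hc]
    omega
  rw [h3]
  exact ⟨(l + 1) * c, by rw [← mul_assoc (p - 1)]; omega⟩

theorem sum_quadraticChar_trace_eq_zero [DecidableEq F] {m : ℕ} (hF : ringChar F ≠ 2)
    (hp2 : p ≠ 2) (hmeven : Even m) (hcard : Fintype.card F = p ^ m) :
    (∑ x : F with Algebra.trace (ZMod p) F x = 0, (quadraticChar F x : ℂ)) * p
      = (p - 1) * quadraticGaussSum (traceChar p F) := by
  have h : ∑ x : F, ∑ y : ZMod p,
      (quadraticChar F x : ℂ) * traceChar p F (algebraMap (ZMod p) F y * x)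
      = (p - 1) * quadraticGaussSum (traceChar p F) := by
    rw [Finset.sum_comm, ← Finset.add_sum_erase _ _ (Finset.mem_univ (0 : ZMod p)),
      Finset.sum_congr (rfl : univ.erase (0 : ZMod p) = _)
        (g := fun _ => quadraticGaussSum (traceChar p F))]
    · have : ∑ x : F, (quadraticChar F x : ℂ) = 0 := by
        exact_mod_cast quadraticChar_sum_zero hF
      simp only [map_zero, zero_mul, AddChar.map_zero_eq_one, mul_one, this]
      simp [Finset.card_erase_of_mem, ZMod.card, Nat.cast_sub (Fact.out : p.Prime).one_le]
    · intro y hy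
      have hy := Finset.ne_of_mem_erase hy
      have h := quadraticGaussSum_mulShift (traceChar p F)
        (a := algebraMap (ZMod p) F y) (by simpa using hy)
      rw [quadraticChar_algebraMap hF hp2 hmeven hcard hy] at h
      simpa [quadraticGaussSum_eq_sum, AddChar.mulShift_apply] using h
  simp_rw [← Finset.mul_sum, traceChar_algebraMap_mul, sum_stdAddChar_mul] at h
  rw [← h, Finset.sum_filter, Finset.sum_mul]
  refine Finset.sum_congr rfl fun x _ => ?_
  split_ifs <;> simp

theorem sum_stdAddChar_neg_sq_div (hp2 : p ≠ 2) (t : ZMod p) :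
    ∑ y ∈ univ.erase (0 : ZMod p), ∑ z : ZMod p, (ZMod.stdAddChar (-(z ^ 2 / (4 * y) * t)) : ℂ)
      = if t = 0 then ((p : ℂ) - 1) * p else 0 := by
  have hp1 := (Fact.out : p.Prime).one_le
  split_ifs with ht
  · simp [ht, Finset.card_erase_of_mem, ZMod.card, Nat.cast_sub hp1]
  have h2 : (2 : ZMod p) ≠ 0 := Ring.two_ne_zero (by rwa [ZMod.ringChar_zmod_n])
  have h4 : (4 : ZMod p) ≠ 0 := by
    have : (4 : ZMod p) = 2 * 2 := by norm_num
    rw [this]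
    exact mul_ne_zero h2 h2
  have hz : ∀ z : ZMod p, z ≠ 0 →
      ∑ y ∈ univ.erase (0 : ZMod p), (ZMod.stdAddChar (-(z ^ 2 / (4 * y) * t)) : ℂ) = -1 := by
    intro z hz
    have h : ∑ y ∈ univ.erase (0 : ZMod p), (ZMod.stdAddChar (-(z ^ 2 / (4 * y) * t)) : ℂ)
        = ∑ u ∈ univ.erase (0 : ZMod p), ZMod.stdAddChar (u * 1) := by
      have hne : ∀ y : ZMod p, y ≠ 0 → -(z ^ 2 / (4 * y) * t) ≠ 0 := fun y hy =>
        neg_ne_zero.mpr (mul_ne_zero (div_ne_zero (pow_ne_zero _ hz) (mul_ne_zero h4 hy)) ht)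
      refine Finset.sum_nbij' (fun y => -(z ^ 2 / (4 * y) * t)) (fun y => -(z ^ 2 / (4 * y) * t))
        ?_ ?_ ?_ ?_ ?_
      · simpa using hne
      · simpa using hne
      · intro y hy
        have := Finset.ne_of_mem_erase hy
        field_simp
      · intro y hy
        have := Finset.ne_of_mem_erase hy
        field_simp
      · simp
    have h1 := sum_stdAddChar_mul p 1
    rw [← Finset.add_sum_erase _ _ (Finset.mem_univ (0 : ZMod p)), ← h] at h1
    simp only [zero_mul, AddChar.map_zero_eq_one, one_ne_zero, if_false] at h1
    linear_combination h1
  rw [Finset.sum_comm, ← Finset.add_sum_erase _ _ (Finset.mem_univ (0 : ZMod p)),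
    Finset.sum_congr rfl (fun z h => hz z (Finset.ne_of_mem_erase h))]
  simp [Finset.card_erase_of_mem, ZMod.card]

theorem card_trace_eq_zero_trace_mul_sq_eq_zero [DecidableEq F] {m : ℕ} (hF : ringChar F ≠ 2)
    (hp2 : p ≠ 2) (hmeven : Even m) (hcard : Fintype.card F = p ^ m) {a : F} (ha : a ≠ 0) :
    (#{x : F | Algebra.trace (ZMod p) F x = 0 ∧ Algebra.trace (ZMod p) F (a * x ^ 2) = 0} : ℂ)
      * p ^ 2 = p ^ m + if Algebra.trace (ZMod p) F a⁻¹ = 0 then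
        (p - 1) * p * (quadraticChar F a * quadraticGaussSum (traceChar p F)) else 0 := by
  let T := Algebra.trace (ZMod p) F
  let ι := algebraMap (ZMod p) F
  have h : ∑ y : ZMod p, ∑ z : ZMod p, ∑ x : F, traceChar p F (ι y * (a * x ^ 2) + ι z * x)
      = p ^ m + if T a⁻¹ = 0 then
        (p - 1) * p * (quadraticChar F a * quadraticGaussSum (traceChar p F)) else 0 := by
    rw [← Finset.add_sum_erase _ _ (Finset.mem_univ (0 : ZMod p))]
    congr 1
    · simp [ι, sum_traceChar_algebraMap_mul, hcard]
    have key : ∀ y ∈ univ.erase (0 : ZMod p), ∀ z : ZMod p,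
        ∑ x : F, traceChar p F (ι y * (a * x ^ 2) + ι z * x)
          = ZMod.stdAddChar (-(z ^ 2 / (4 * y) * T a⁻¹))
            * (quadraticChar F a * quadraticGaussSum (traceChar p F)) := by
      intro y hy z
      have hy := Finset.ne_of_mem_erase hy
      have hy' : ι y ≠ 0 := by simpa [ι] using hy
      have h := sum_addChar_quadratic hF (isPrimitive_traceChar p) (mul_ne_zero hy' ha) (ι z)
      rw [map_mul, quadraticChar_algebraMap hF hp2 hmeven hcard hy, one_mul] at h
      simp_rw [← mul_assoc]
      rw [h, ← mul_assoc, ← neg_mul, ← traceChar_algebraMap_mul]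
      congr 3
      simp only [map_neg, map_div₀, map_pow, map_mul, map_ofNat, ι]
      rw [neg_mul, ← div_eq_mul_inv, div_div, mul_assoc]
    rw [Finset.sum_congr rfl fun y hy => Finset.sum_congr rfl fun z _ => key y hy z]
    simp_rw [← Finset.sum_mul]
    rw [sum_stdAddChar_neg_sq_div hp2]
    split_ifs <;> simp
  rw [← h]
  have hsplit : ∀ x : F, ∑ y : ZMod p, ∑ z : ZMod p,
      traceChar p F (ι y * (a * x ^ 2) + ι z * x)
        = if T x = 0 ∧ T (a * x ^ 2) = 0 then (p : ℂ) ^ 2 else 0 := by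
    intro x
    simp_rw [AddChar.map_add_eq_mul, ι, traceChar_algebraMap_mul, ← Finset.mul_sum,
      ← Finset.sum_mul, sum_stdAddChar_mul]
    by_cases h1 : T x = 0 <;> by_cases h2 : T (a * x ^ 2) = 0 <;> simp [T] at h1 h2 <;>
      simp [T, sq, *]
  have hcomm : ∑ y : ZMod p, ∑ z : ZMod p, ∑ x : F,
      traceChar p F (ι y * (a * x ^ 2) + ι z * x)
      = ∑ x : F, ∑ y : ZMod p, ∑ z : ZMod p,
      traceChar p F (ι y * (a * x ^ 2) + ι z * x) := by
    rw [Finset.sum_comm (s := (univ : Finset F))]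
    exact Finset.sum_congr rfl fun y _ => Finset.sum_comm
  rw [hcomm, Finset.sum_congr rfl fun x _ => hsplit x, ← Finset.sum_filter, Finset.sum_const,
    nsmul_eq_mul]

end TraceCharacter

section Weights

variable {p : ℕ} [Fact p.Prime] {F : Type} [Field F] [Fintype F] [Algebra (ZMod p) F]

theorem codewordWeight_add_card [DecidableEq F] (a : F) :
    codewordWeight p F a
      + #{x : F | Algebra.trace (ZMod p) F x = 0 ∧ Algebra.trace (ZMod p) F (a * x ^ 2) = 0}
      = #{x : F | Algebra.trace (ZMod p) F x = 0} := by
  have h : codewordWeight p F a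
      = #{x : F | Algebra.trace (ZMod p) F x = 0 ∧ ¬ Algebra.trace (ZMod p) F (a * x ^ 2) = 0} := by
    rw [codewordWeight, ← Set.ncard_coe_finset]
    congr 1
    ext x
    simp only [Set.mem_ofPred_eq, Finset.coe_filter, Finset.mem_univ, true_and]
    refine ⟨fun h => h.2, fun h => ⟨?_, h⟩⟩
    rintro rfl
    exact h.2 (by simp)
  rw [h, ← Finset.filter_filter, ← Finset.filter_filter, add_comm,
    Finset.card_filter_add_card_filter_not]

theorem exists_sign_quadraticGaussSum [DecidableEq F] (hF : ringChar F ≠ 2) (hp2 : p ≠ 2) {k : ℕ}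
    (hcard : Fintype.card F = p ^ (2 * k + 2)) :
    ∃ s : ℤ, (s = 1 ∨ s = -1) ∧ quadraticGaussSum (traceChar p F) = s * (p * p ^ k) := by
  have h := quadraticGaussSum_sq hF (isPrimitive_traceChar p (F := F))
  have h1 := quadraticChar_algebraMap (F := F) hF hp2 ⟨k + 1, by ring⟩ hcard
    (neg_ne_zero.mpr one_ne_zero : (-1 : ZMod p) ≠ 0)
  rw [map_neg, map_one] at h1
  rw [h1, hcard] at h
  have h2 : quadraticGaussSum (traceChar p F) ^ 2 = ((p : ℂ) * p ^ k) ^ 2 := by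
    rw [h]
    push_cast
    ring
  rcases sq_eq_sq_iff_eq_or_eq_neg.mp h2 with h | h
  · exact ⟨1, Or.inl rfl, by simp [h]⟩
  · exact ⟨-1, Or.inr rfl, by simp [h]⟩

theorem card_trace_eq_zero {k : ℕ} [DecidableEq F] (hcard : Fintype.card F = p ^ (2 * k + 2)) :
    #{x : F | Algebra.trace (ZMod p) F x = 0} = p * (p ^ k) ^ 2 := by
  have h := card_trace_eq_zero_mul p (F := F)
  rw [hcard] at h
  have h' : #{x : F | Algebra.trace (ZMod p) F x = 0} * p = p ^ (2 * k + 2) := by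
    exact_mod_cast h
  exact Nat.eq_of_mul_eq_mul_right (Fact.out : p.Prime).pos (h'.trans (by ring))

theorem codewordWeight_eq [DecidableEq F] (hF : ringChar F ≠ 2) (hp2 : p ≠ 2) {k : ℕ}
    (hcard : Fintype.card F = p ^ (2 * k + 2)) {s : ℤ}
    (hs : quadraticGaussSum (traceChar p F) = s * (p * p ^ k)) {a : F} (ha : a ≠ 0) :
    (codewordWeight p F a : ℤ) = ((p : ℤ) - 1) * ((p ^ k) ^ 2 -
      if Algebra.trace (ZMod p) F a⁻¹ = 0 then quadraticChar F a * s * p ^ k else 0) := by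
  have h1 := codewordWeight_add_card (p := p) a
  rw [card_trace_eq_zero hcard] at h1
  have h2 := card_trace_eq_zero_trace_mul_sq_eq_zero hF hp2 ⟨k + 1, by ring⟩ hcard ha
  set N := #{x : F | Algebra.trace (ZMod p) F x = 0 ∧ Algebra.trace (ZMod p) F (a * x ^ 2) = 0}
  have h3 : (N : ℤ) * p ^ 2 = p ^ (2 * k + 2) + if Algebra.trace (ZMod p) F a⁻¹ = 0 then
      (p - 1) * p * (quadraticChar F a * (s * (p * p ^ k))) else 0 := by
    rw [hs] at h2
    split_ifs at h2 ⊢ <;> exact_mod_cast h2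
  have hp0 : (p : ℤ) ^ 2 ≠ 0 := by have := (Fact.out : p.Prime).pos; positivity
  have h4 : (codewordWeight p F a : ℤ) + N = p * (p ^ k) ^ 2 := by exact_mod_cast h1
  apply mul_right_cancel₀ hp0
  split_ifs at h3 ⊢ <;> linear_combination (p : ℤ) ^ 2 * h4 - h3

theorem two_mul_card_trace_eq_zero_quadraticChar_eq [DecidableEq F] (hF : ringChar F ≠ 2)
    (hp2 : p ≠ 2) {k : ℕ} (hcard : Fintype.card F = p ^ (2 * k + 2)) {s : ℤ}
    (hs : quadraticGaussSum (traceChar p F) = s * (p * p ^ k)) {σ : ℤ} (hσ : σ = 1 ∨ σ = -1) :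
    2 * (#{b : F | Algebra.trace (ZMod p) F b = 0 ∧ quadraticChar F b = σ} : ℤ)
      = p * (p ^ k) ^ 2 - 1 + σ * s * ((p - 1) * p ^ k) := by
  have hp0 : (p : ℂ) ≠ 0 := by exact_mod_cast (Fact.out : p.Prime).ne_zero
  have h1 := sum_quadraticChar_trace_eq_zero hF hp2 ⟨k + 1, by ring⟩ hcard
  rw [hs] at h1
  have h2 : ∑ x : F with Algebra.trace (ZMod p) F x = 0, quadraticChar F x
      = s * ((p - 1) * p ^ k) := by
    have h : (∑ x : F with Algebra.trace (ZMod p) F x = 0, (quadraticChar F x : ℂ))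
        = s * ((p - 1) * p ^ k) := by
      apply mul_right_cancel₀ hp0
      linear_combination h1
    exact_mod_cast h
  have h3 : ∀ x : F, 2 * (if quadraticChar F x = σ then 1 else 0 : ℤ)
      = 1 - (if x = 0 then 1 else 0) + σ * quadraticChar F x := by
    intro x
    rcases eq_or_ne x 0 with rfl | hx
    · rcases hσ with rfl | rfl <;> simp
    · rcases quadraticChar_dichotomy hx with h | h <;> rcases hσ with rfl | rfl <;> simp [h, hx]
  have h4 : (∑ x : F with Algebra.trace (ZMod p) F x = 0, if x = 0 then 1 else 0 : ℤ) = 1 := by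
    simp
  rw [← Finset.filter_filter, Finset.card_filter, Nat.cast_sum, Finset.mul_sum]
  push_cast
  rw [Finset.sum_congr rfl fun x _ => h3 x, Finset.sum_add_distrib, Finset.sum_sub_distrib,
    ← Finset.mul_sum, h2, h4]
  simp [card_trace_eq_zero hcard, mul_assoc]

end Weights

theorem ncard_setOf_inv {F : Type} [Field F] [Fintype F] (P : F → Prop) [DecidablePred P] :
    {a : F | P a⁻¹}.ncard = #{b : F | P b} := by
  rw [← Set.ncard_coe_finset, ← Set.ncard_image_of_injective _ (inv_injective (G := F))]
  congr 1
  ext x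
  simp

theorem stmt_15 (p m : ℕ) [Fact p.Prime] (hp2 : p ≠ 2) (hm : 2 ≤ m) (hmeven : Even m)
    (F : Type) [Field F] [Fintype F] [Algebra (ZMod p) F]
    (hcard : Fintype.card F = p ^ m) :
    ({a : F | a ≠ 0 ∧ codewordWeight p F a = (p - 1) * p ^ (m - 2)}).ncard
        = p ^ m - p ^ (m - 1) ∧
    2 * ({a : F | a ≠ 0 ∧
          codewordWeight p F a = (p - 1) * (p ^ (m - 2) + p ^ ((m - 2) / 2))}).ncard
        = (p ^ (m / 2) + 1) * (p ^ ((m - 2) / 2) - 1) ∧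
    2 * ({a : F | a ≠ 0 ∧
          codewordWeight p F a = (p - 1) * (p ^ (m - 2) - p ^ ((m - 2) / 2))}).ncard
        = (p ^ (m / 2) - 1) * (p ^ ((m - 2) / 2) + 1) := by
  classical
  obtain ⟨k, rfl⟩ : ∃ k, m = 2 * k + 2 := by
    obtain ⟨l, rfl⟩ := hmeven
    exact ⟨l - 1, by omega⟩
  have hF : ringChar F ≠ 2 := by
    have := charP_of_injective_algebraMap (algebraMap (ZMod p) F).injective p
    rwa [ringChar.eq F p]
  obtain ⟨s, hs, hG⟩ := exists_sign_quadraticGaussSum (F := F) hF hp2 hcard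
  have hp1 := (Fact.out : p.Prime).one_lt
  have hq1 : 1 ≤ p ^ k := Nat.one_le_pow _ _ (by omega)
  have e1 : p ^ (2 * k + 2 - 2) = (p ^ k) ^ 2 := by
    rw [Nat.add_sub_cancel]
    ring
  have e2 : (2 * k + 2 - 2) / 2 = k := by omega
  have e3 : (2 * k + 2) / 2 = k + 1 := by omega
  have e4 : 2 * k + 2 - 1 = 2 * k + 1 := by omega
  rw [e1, e2, e3, e4]
  have hwt := fun {a : F} (ha : a ≠ 0) => codewordWeight_eq hF hp2 hcard hG ha
  have hcount := fun {σ : ℤ} (hσ : σ = 1 ∨ σ = -1) =>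
    two_mul_card_trace_eq_zero_quadraticChar_eq hF hp2 hcard hG hσ
  have hker := card_trace_eq_zero (F := F) hcard
  have hη : ∀ a : F, quadraticChar F a⁻¹ = quadraticChar F a := by
    intro a
    rcases eq_or_ne a 0 with rfl | ha
    · simp
    have h : quadraticChar F a⁻¹ * quadraticChar F a = 1 := by
      rw [← map_mul, inv_mul_cancel₀ ha, map_one]
    rcases quadraticChar_dichotomy ha with h' | h' <;> rw [h'] at h ⊢ <;> lia
  have hqq : p ^ k ≤ (p ^ k) ^ 2 := Nat.le_self_pow two_ne_zero _
  generalize hq : p ^ k = q at *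
  have hP : ((p : ℤ) - 1) ≠ 0 := by omega
  have hq0 : (q : ℤ) ≠ 0 := by omega
  have hqc : (p : ℤ) ^ k = q := by exact_mod_cast hq
  simp only [hqc] at hwt hcount
  have hset : ∀ (w : ℕ) (δ : ℤ), (w : ℤ) = ((p : ℤ) - 1) * ((q : ℤ) ^ 2 - δ * q) →
      ∀ a : F, a ≠ 0 ∧ codewordWeight p F a = w ↔
        a ≠ 0 ∧ (if Algebra.trace (ZMod p) F a⁻¹ = 0 then quadraticChar F a * s else 0) = δ := by
    intro w δ hw a
    refine and_congr_right fun ha => ?_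
    rw [← Int.natCast_inj (m := codewordWeight p F a), hw, hwt ha,
      mul_right_inj' hP, sub_right_inj]
    rw [← mul_left_inj' hq0 (b := δ), ite_mul, zero_mul]
  have hs0 : s ≠ 0 := by rcases hs with rfl | rfl <;> decide
  have hss : s * s = 1 := by rcases hs with rfl | rfl <;> rfl
  have hsign : ∀ (w : ℕ) (δ : ℤ), (δ = 1 ∨ δ = -1) →
      (w : ℤ) = ((p : ℤ) - 1) * ((q : ℤ) ^ 2 - δ * q) →
      2 * (({a : F | a ≠ 0 ∧ codewordWeight p F a = w}).ncard : ℤ)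
        = p * q ^ 2 - 1 + δ * ((p - 1) * q) := by
    intro w δ hδ hw
    have hσ : δ * s = 1 ∨ δ * s = -1 := by
      rcases hs with rfl | rfl <;> rcases hδ with rfl | rfl <;> decide
    have h := hcount hσ
    rw [mul_assoc δ, hss, mul_one] at h
    rw [← h, ← ncard_setOf_inv]
    congr 3
    ext a
    rw [Set.mem_ofPred_eq, hset w δ hw, Set.mem_ofPred_eq, hη]
    rcases eq_or_ne a 0 with rfl | ha
    · have : δ * s ≠ 0 := by rcases hσ with h | h <;> rw [h] <;> decide
      simp [this.symm]
    have hδ0 : δ ≠ 0 := by rcases hδ with rfl | rfl <;> decide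
    by_cases ht : Algebra.trace (ZMod p) F a⁻¹ = 0
    · simp only [ha, ht, ne_eq, not_false_eq_true, if_true, true_and]
      constructor
      · rintro rfl
        rw [mul_assoc, hss, mul_one]
      · intro h
        rw [h, mul_assoc, hss, mul_one]
    · simp [ht, hδ0.symm]
  refine ⟨?_, ?_, ?_⟩
  · have h : {a : F | a ≠ 0 ∧ codewordWeight p F a = (p - 1) * q ^ 2}
        = {a : F | ¬ Algebra.trace (ZMod p) F a⁻¹ = 0} := by
      ext a
      rw [Set.mem_ofPred_eq, hset _ 0 (by push_cast [Nat.cast_sub hp1.le]; ring), Set.mem_ofPred_eq]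
      rcases eq_or_ne a 0 with rfl | ha
      · simp
      · rcases quadraticChar_dichotomy ha with h | h <;> simp [ha, h, hs0]
    rw [h, ncard_setOf_inv (fun b : F => ¬ Algebra.trace (ZMod p) F b = 0)]
    have h1 := Finset.card_filter_add_card_filter_not (s := (univ : Finset F))
      (fun b => Algebra.trace (ZMod p) F b = 0)
    rw [hker, Finset.card_univ, hcard] at h1
    have h2 : p ^ (2 * k + 1) = p * q ^ 2 := by
      rw [← hq]
      ring
    omega
  · have h := hsign ((p - 1) * (q ^ 2 + q)) (-1) (Or.inr rfl)
      (by push_cast [Nat.cast_sub hp1.le]; ring)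
    refine Nat.cast_injective (R := ℤ) ?_
    rw [Nat.cast_mul, Nat.cast_ofNat, h]
    push_cast [Nat.cast_sub hq1, pow_succ, hqc]
    ring
  · have h := hsign ((p - 1) * (q ^ 2 - q)) 1 (Or.inl rfl)
      (by push_cast [Nat.cast_sub hp1.le, Nat.cast_sub hqq]; ring)
    have h1 : 1 ≤ p ^ (k + 1) := Nat.one_le_pow _ _ (by omega)
    refine Nat.cast_injective (R := ℤ) ?_
    rw [Nat.cast_mul, Nat.cast_ofNat, h]
    rw [Nat.cast_mul, Nat.cast_sub h1]
    push_cast [pow_succ, hqc]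
    ring
end

section
/- Let m be odd. Then, with wt(a) = #{x ∈ F_r^* : Tr(x) = 0 and Tr(ax²) ≠ 0}: the number of a ∈ F_r^* with wt(a) = (p−1)p^{m-2} is p^{m-1} − 1; the number of a ∈ F_r^* with wt(a) = (p−1)(p^{m-2} − p^{(m-3)/2}) is (p−1)(p^{m-1} + p^{(m-1)/2})/2; and the number of a ∈ F_r^* with wt(a) = (p−1)(p^{m-2} + p^{(m-3)/2}) is (p−1)(p^{m-1} − p^{(m-1)/2})/2. -/
theorem four_ne_zero_of_ringChar_ne_two {K : Type*} [Field K] (hK : ringChar K ≠ 2) :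
    (4 : K) ≠ 0 := by
  have h : (4 : K) = 2 ^ 2 := by norm_num
  rw [h]
  exact pow_ne_zero 2 (Ring.two_ne_zero hK)

/-- The quadratic character of a finite field, with complex values. -/
noncomputable def complexQuadraticChar (K : Type*) [Field K] [Fintype K] [DecidableEq K] :
    MulChar K ℂ :=
  (quadraticChar K).ringHomComp (Int.castRingHom ℂ)

theorem complexQuadraticChar_apply {K : Type*} [Field K] [Fintype K] [DecidableEq K] (x : K) :
    complexQuadraticChar K x = (quadraticChar K x : ℂ) := rfl

theorem complexQuadraticChar_isQuadratic (K : Type*) [Field K] [Fintype K] [DecidableEq K] :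
    (complexQuadraticChar K).IsQuadratic :=
  (quadraticChar_isQuadratic K).comp _

theorem complexQuadraticChar_ne_one {K : Type*} [Field K] [Fintype K] [DecidableEq K]
    (hK : ringChar K ≠ 2) : complexQuadraticChar K ≠ 1 :=
  (MulChar.ringHomComp_ne_one_iff (Int.cast_injective (α := ℂ))).2 (quadraticChar_ne_one hK)

theorem sum_quadraticChar_mul_addChar {K : Type*} [Field K] [Fintype K] [DecidableEq K]
    (hK : ringChar K ≠ 2) (χ : AddChar K ℂ) (c : K) :
    ∑ x, (quadraticChar K x : ℂ) * χ (c * x) =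
      quadraticChar K c * gaussSum (complexQuadraticChar K) χ := by
  rcases eq_or_ne c 0 with rfl | hc
  · simpa using congrArg (Int.cast (R := ℂ)) (quadraticChar_sum_zero hK)
  · have h := gaussSum_mulShift_eq (complexQuadraticChar K) χ (Units.mk0 c hc)
    rw [(complexQuadraticChar_isQuadratic K).inv] at h
    simpa [gaussSum, AddChar.mulShift_apply, complexQuadraticChar_apply] using h

theorem sum_addChar_mul_sq {K : Type*} [Field K] [Fintype K] [DecidableEq K]
    (hK : ringChar K ≠ 2) {χ : AddChar K ℂ} (hχ : χ.IsPrimitive) {c : K} (hc : c ≠ 0) :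
    ∑ x, χ (c * x ^ 2) = quadraticChar K c * gaussSum (complexQuadraticChar K) χ := by
  have hcount (y : K) : (((Finset.univ.filter fun x : K => x ^ 2 = y).card : ℕ) : ℂ) =
      quadraticChar K y + 1 := by
    have h := quadraticChar_card_sqrts hK y
    rw [Set.toFinset_ofPred] at h
    exact_mod_cast h
  calc ∑ x, χ (c * x ^ 2)
      = ∑ y, ∑ x with x ^ 2 = y, χ (c * x ^ 2) := (Finset.sum_fiberwise _ _ _).symm
    _ = ∑ y, ((quadraticChar K y : ℂ) * χ (c * y) + χ (y * c)) := by
        refine Finset.sum_congr rfl fun y _ => ?_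
        rw [Finset.sum_congr rfl (g := fun _ => χ (c * y))
          (fun x hx => by rw [(Finset.mem_filter.1 hx).2]), Finset.sum_const, nsmul_eq_mul,
          hcount, mul_comm y c]
        ring
    _ = _ := by
        rw [Finset.sum_add_distrib, sum_quadraticChar_mul_addChar hK,
          AddChar.sum_mulShift c hχ, if_neg hc, Nat.cast_zero, add_zero]

theorem sum_addChar_mul_sq_add_mul {K : Type*} [Field K] [Fintype K] [DecidableEq K]
    (hK : ringChar K ≠ 2) {χ : AddChar K ℂ} (hχ : χ.IsPrimitive) {c : K} (hc : c ≠ 0) (d : K) :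
    ∑ x, χ (c * x ^ 2 + d * x) =
      quadraticChar K c * gaussSum (complexQuadraticChar K) χ * χ (-(d ^ 2 / (4 * c))) := by
  have h2 : (2 : K) ≠ 0 := Ring.two_ne_zero hK
  have h4 : (4 : K) ≠ 0 := four_ne_zero_of_ringChar_ne_two hK
  rw [← sum_addChar_mul_sq hK hχ hc, Finset.sum_mul,
    ← Equiv.sum_comp (Equiv.addRight (d / (2 * c))) fun x => χ (c * x ^ 2) * χ (-(d ^ 2 / (4 * c)))]
  refine Finset.sum_congr rfl fun x _ => ?_
  rw [← AddChar.map_add_eq_mul, Equiv.coe_addRight]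
  congr 1
  field_simp
  ring

theorem quadraticChar_four_mul {K : Type*} [Field K] [Fintype K] [DecidableEq K]
    (hK : ringChar K ≠ 2) (x : K) : quadraticChar K (4 * x) = quadraticChar K x := by
  have h4 : (4 : K) = 2 ^ 2 := by norm_num
  rw [map_mul, h4, quadraticChar_sq_one' (Ring.two_ne_zero hK), one_mul]

theorem quadraticChar_inv {K : Type*} [Field K] [Fintype K] [DecidableEq K] (x : K) :
    quadraticChar K x⁻¹ = quadraticChar K x := by
  rcases eq_or_ne x 0 with rfl | hx
  · simp
  · have h : x⁻¹ = x * x⁻¹ ^ 2 := by field_simp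
    rw [h, map_mul, quadraticChar_sq_one' (inv_ne_zero hx), mul_one]

theorem quadraticChar_algebraMap_of_odd {K L : Type*} [Field K] [Fintype K] [DecidableEq K]
    [Field L] [Fintype L] [DecidableEq L] [Algebra K L] (hK : ringChar K ≠ 2)
    (hL : ringChar L ≠ 2) {m : ℕ} (hm : Odd m) (hcard : Fintype.card L = Fintype.card K ^ m)
    (s : K) : quadraticChar L (algebraMap K L s) = quadraticChar K s := by
  rcases eq_or_ne s 0 with rfl | hs
  · simp
  have hsL : algebraMap K L s ≠ 0 := by simpa using hs
  have hq := FiniteField.odd_card_of_char_ne_two hK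
  have hq' : Odd (Fintype.card K) := Nat.odd_iff.2 hq
  have hfac : Fintype.card L / 2 =
      (Fintype.card K / 2) * ∑ i ∈ Finset.range m, Fintype.card K ^ i := by
    obtain ⟨k, hk⟩ := hq'
    have h := geom_sum_mul_add (2 * k) m
    rw [hcard, hk, ← h, show (2 * k + 1) / 2 = k by omega, mul_left_comm, mul_comm k]
    omega
  have hodd : Odd (∑ i ∈ Finset.range m, Fintype.card K ^ i) := by
    rw [Finset.odd_sum_iff_odd_card_odd, Finset.filter_true_of_mem fun i _ => hq'.pow,
      Finset.card_range]
    exact hm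
  have h1 : ((quadraticChar L (algebraMap K L s) : ℤ) : L) = (quadraticChar K s : ℤ) := by
    rw [quadraticChar_eq_pow_of_char_ne_two' hL, hfac, pow_mul, ← map_pow,
      ← quadraticChar_eq_pow_of_char_ne_two' hK, map_intCast]
    rcases quadraticChar_dichotomy hs with h | h <;> simp [h, hodd.neg_one_pow]
  have hne : (1 : L) ≠ -1 := Ring.neg_one_ne_one_of_char_ne_two hL |>.symm
  rcases quadraticChar_dichotomy hs with h | h <;>
    rcases quadraticChar_dichotomy hsL with h' | h' <;> simp_all

theorem AddChar.IsPrimitive.comp_trace {K L R : Type*} [Field K] [Field L] [Finite K] [Finite L]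
    [Algebra K L] [CommRing R] {ψ : AddChar K R} (hψ : ψ.IsPrimitive) :
    (ψ.compAddMonoidHom (Algebra.trace K L).toAddMonoidHom).IsPrimitive := by
  refine AddChar.IsPrimitive.of_ne_one ?_
  have h1 : ψ ≠ 1 := by simpa [AddChar.mulShift_one] using hψ one_ne_zero
  obtain ⟨s, hs⟩ := AddChar.ne_one_iff.1 h1
  obtain ⟨x, hx⟩ := Algebra.trace_surjective K L s
  exact AddChar.ne_one_iff.2 ⟨x, by simpa [hx] using hs⟩

section TraceCharacter

variable {K L : Type*} [Field K] [Fintype K] [DecidableEq K] [Field L] [Fintype L] [DecidableEq L]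
  [Algebra K L]

/-- The character sum attached to the number of common zeros of `Tr x` and `Tr (a x²)`. -/
theorem sum_addChar_trace_mul_sq_add (hK : ringChar K ≠ 2) (hL : ringChar L ≠ 2) {m : ℕ}
    (hm : Odd m) (hcard : Fintype.card L = Fintype.card K ^ m) {ψ : AddChar K ℂ}
    (hψ : ψ.IsPrimitive) {a : L} (ha : a ≠ 0) {s : K} (hs : s ≠ 0) :
    ∑ t, ∑ x, ψ (s * Algebra.trace K L (a * x ^ 2) + t * Algebra.trace K L x) =
      if Algebra.trace K L a⁻¹ = 0 then
        Fintype.card K * quadraticChar L a *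
          gaussSum (complexQuadraticChar L)
            (ψ.compAddMonoidHom (Algebra.trace K L).toAddMonoidHom) * quadraticChar K s
      else quadraticChar L a * quadraticChar K (-Algebra.trace K L a⁻¹) *
        (gaussSum (complexQuadraticChar L)
          (ψ.compAddMonoidHom (Algebra.trace K L).toAddMonoidHom) *
        gaussSum (complexQuadraticChar K) ψ) := by
  set χ := ψ.compAddMonoidHom (Algebra.trace K L).toAddMonoidHom
  have hχ : χ.IsPrimitive := hψ.comp_trace
  have hχ_apply (x : L) : χ x = ψ (Algebra.trace K L x) := rfl
  have htr (s : K) (x : L) : Algebra.trace K L (algebraMap K L s * x) = s * Algebra.trace K L x := by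
    rw [← Algebra.smul_def, map_smul, smul_eq_mul]
  have hsL : algebraMap K L s ≠ 0 := by simpa using hs
  have h4 : (4 : K) ≠ 0 := four_ne_zero_of_ringChar_ne_two hK
  have h4L : (4 : L) ≠ 0 := four_ne_zero_of_ringChar_ne_two hL
  have hinner (t : K) :
      ∑ x, ψ (s * Algebra.trace K L (a * x ^ 2) + t * Algebra.trace K L x) =
        quadraticChar L a * gaussSum (complexQuadraticChar L) χ * quadraticChar K s *
          ψ (-Algebra.trace K L a⁻¹ / (4 * s) * t ^ 2) := by
    have hx (x : L) : ψ (s * Algebra.trace K L (a * x ^ 2) + t * Algebra.trace K L x) =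
        χ (algebraMap K L s * a * x ^ 2 + algebraMap K L t * x) := by
      rw [hχ_apply, map_add (Algebra.trace K L), mul_assoc, htr, htr]
    have hT : -(algebraMap K L t ^ 2 / (4 * (algebraMap K L s * a))) =
        algebraMap K L (-(t ^ 2 / (4 * s))) * a⁻¹ := by
      simp only [map_neg, map_div₀, map_mul, map_pow, map_ofNat]
      field_simp
    simp_rw [hx]
    rw [sum_addChar_mul_sq_add_mul hL hχ (mul_ne_zero hsL ha), hT, hχ_apply, htr, map_mul,
      quadraticChar_algebraMap_of_odd hK hL hm hcard]
    have e : -(t ^ 2 / (4 * s)) * Algebra.trace K L a⁻¹ =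
        -Algebra.trace K L a⁻¹ / (4 * s) * t ^ 2 := by ring
    rw [e]
    push_cast
    ring
  simp_rw [hinner]
  rw [← Finset.mul_sum]
  split_ifs with h
  · simp [h]
    ring
  · have hc : -Algebra.trace K L a⁻¹ / (4 * s) ≠ 0 :=
      div_ne_zero (neg_ne_zero.2 h) (mul_ne_zero h4 hs)
    have hs2 : (quadraticChar K s : ℂ) * quadraticChar K s = 1 := by
      have := quadraticChar_sq_one hs
      rw [sq] at this
      exact_mod_cast this
    rw [sum_addChar_mul_sq hK hψ hc, div_eq_mul_inv, map_mul, quadraticChar_inv,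
      quadraticChar_four_mul hK]
    push_cast
    linear_combination ((quadraticChar L a : ℂ) * gaussSum (complexQuadraticChar L) χ *
      quadraticChar K (-Algebra.trace K L a⁻¹) * gaussSum (complexQuadraticChar K) ψ) * hs2

/-- The number of common zeros of `Tr x` and `Tr (a x²)`, in terms of Gauss sums. -/
theorem card_trace_eq_zero_and_trace_mul_sq_eq_zero (hK : ringChar K ≠ 2) (hL : ringChar L ≠ 2)
    {m : ℕ} (hm : Odd m) (hcard : Fintype.card L = Fintype.card K ^ m) {ψ : AddChar K ℂ}
    (hψ : ψ.IsPrimitive) {a : L} (ha : a ≠ 0) :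
    (Fintype.card K : ℂ) ^ 2 *
        (Finset.univ.filter fun x : L =>
          Algebra.trace K L x = 0 ∧ Algebra.trace K L (a * x ^ 2) = 0).card =
      Fintype.card L + (Fintype.card K - 1) *
        (quadraticChar L a * quadraticChar K (-Algebra.trace K L a⁻¹) *
        (gaussSum (complexQuadraticChar L)
          (ψ.compAddMonoidHom (Algebra.trace K L).toAddMonoidHom) *
        gaussSum (complexQuadraticChar K) ψ)) := by
  have hzero : ∑ t, ∑ x, ψ (t * Algebra.trace K L x) = (Fintype.card L : ℂ) := by
    have hx (t : K) : ∑ x, ψ (t * Algebra.trace K L x) =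
        if t = 0 then (Fintype.card L : ℂ) else 0 := by
      have h := AddChar.sum_mulShift (algebraMap K L t) (hψ.comp_trace (L := L))
      simp only [map_eq_zero] at h
      rw [Nat.cast_ite, Nat.cast_zero] at h
      rw [← h]
      refine Finset.sum_congr rfl fun x _ => ?_
      rw [mul_comm x, ← Algebra.smul_def]
      simp
    simp [hx]
  have hexpand : (Fintype.card K : ℂ) ^ 2 *
        (Finset.univ.filter fun x : L =>
          Algebra.trace K L x = 0 ∧ Algebra.trace K L (a * x ^ 2) = 0).card =
      ∑ s, ∑ t, ∑ x, ψ (s * Algebra.trace K L (a * x ^ 2) + t * Algebra.trace K L x) := by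
    calc _ = ∑ x : L, (∑ s, ψ (s * Algebra.trace K L (a * x ^ 2))) *
          (∑ t, ψ (t * Algebra.trace K L x)) := by
          simp_rw [AddChar.sum_mulShift _ hψ]
          rw [Finset.card_filter, Nat.cast_sum, Finset.mul_sum]
          refine Finset.sum_congr rfl fun x _ => ?_
          split_ifs <;> simp_all [sq]
      _ = ∑ x : L, ∑ s, ∑ t, ψ (s * Algebra.trace K L (a * x ^ 2) + t * Algebra.trace K L x) := by
          simp_rw [Finset.sum_mul_sum, AddChar.map_add_eq_mul]
      _ = _ := by
          rw [Finset.sum_comm]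
          exact Finset.sum_congr rfl fun s _ => Finset.sum_comm
  rw [hexpand, ← Finset.add_sum_erase _ _ (Finset.mem_univ (0 : K)),
    Finset.sum_congr rfl fun s hs => sum_addChar_trace_mul_sq_add hK hL hm hcard hψ ha
      (Finset.ne_of_mem_erase hs)]
  simp only [zero_mul, zero_add, hzero]
  congr 1
  split_ifs with h
  · have hsum : ∑ s ∈ Finset.univ.erase (0 : K), (quadraticChar K s : ℂ) = 0 := by
      have h0 := Finset.add_sum_erase Finset.univ (fun s : K => quadraticChar K s)
        (Finset.mem_univ (0 : K))
      rw [quadraticChar_sum_zero hK] at h0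
      simp only [MulChar.map_zero, zero_add] at h0
      exact_mod_cast h0
    rw [← Finset.mul_sum, hsum, h]
    simp
  · rw [Finset.sum_const, Finset.card_erase_of_mem (Finset.mem_univ _), Finset.card_univ,
      nsmul_eq_mul, Nat.cast_sub Fintype.card_pos, Nat.cast_one]

theorem gaussSum_mul_sum_quadraticChar_trace (hK : ringChar K ≠ 2) (hL : ringChar L ≠ 2)
    {m : ℕ} (hm : Odd m) (hcard : Fintype.card L = Fintype.card K ^ m) (ψ : AddChar K ℂ) :
    gaussSum (complexQuadraticChar K) ψ *
        ∑ b : L, (quadraticChar L b : ℂ) * quadraticChar K (-Algebra.trace K L b) =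
      quadraticChar K (-1) * (Fintype.card K - 1) *
        gaussSum (complexQuadraticChar L)
          (ψ.compAddMonoidHom (Algebra.trace K L).toAddMonoidHom) := by
  set χ := ψ.compAddMonoidHom (Algebra.trace K L).toAddMonoidHom with hχdef
  have hs (s : K) : (quadraticChar K s : ℂ) * (quadraticChar K (-s) : ℂ) =
      if s = 0 then 0 else (quadraticChar K (-1) : ℂ) := by
    split_ifs with h
    · simp [h]
    · have h2 : (quadraticChar K s : ℂ) * quadraticChar K s = 1 := by
        have := quadraticChar_sq_one h
        rw [sq] at this
        exact_mod_cast this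
      rw [← neg_one_mul s, map_mul]
      push_cast
      linear_combination (quadraticChar K (-1) : ℂ) * h2
  calc _ = ∑ b : L, (quadraticChar L b : ℂ) *
        ∑ s, (quadraticChar K s : ℂ) * ψ (-Algebra.trace K L b * s) := by
        rw [Finset.mul_sum]
        refine Finset.sum_congr rfl fun b _ => ?_
        rw [sum_quadraticChar_mul_addChar hK]
        ring
    _ = ∑ s, (quadraticChar K s : ℂ) *
        ∑ b : L, (quadraticChar L b : ℂ) * χ (algebraMap K L (-s) * b) := by
        simp_rw [Finset.mul_sum]
        rw [Finset.sum_comm]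
        refine Finset.sum_congr rfl fun s _ => Finset.sum_congr rfl fun b _ => ?_
        have e : χ (algebraMap K L (-s) * b) = ψ (-Algebra.trace K L b * s) := by
          rw [← Algebra.smul_def]
          simp [hχdef, mul_comm]
        rw [e]
        ring
    _ = ∑ s : K, (if s = 0 then 0 else (quadraticChar K (-1) : ℂ)) *
          gaussSum (complexQuadraticChar L) χ := by
        refine Finset.sum_congr rfl fun s _ => ?_
        rw [sum_quadraticChar_mul_addChar hL, quadraticChar_algebraMap_of_odd hK hL hm hcard,
          ← mul_assoc, hs]
    _ = _ := by
        rw [← Finset.sum_mul, ← Finset.sum_erase_add _ _ (Finset.mem_univ (0 : K)),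
          Finset.sum_congr rfl fun s hs => if_neg (Finset.ne_of_mem_erase hs), Finset.sum_const,
          Finset.card_erase_of_mem (Finset.mem_univ _), Finset.card_univ,
          nsmul_eq_mul, Nat.cast_sub Fintype.card_pos, Nat.cast_one, if_pos rfl]
        ring

theorem sq_gaussSum_mul_gaussSum (hK : ringChar K ≠ 2) (hL : ringChar L ≠ 2)
    {m : ℕ} (hm : Odd m) (hcard : Fintype.card L = Fintype.card K ^ m) {ψ : AddChar K ℂ}
    (hψ : ψ.IsPrimitive) :
    (gaussSum (complexQuadraticChar L)
        (ψ.compAddMonoidHom (Algebra.trace K L).toAddMonoidHom) *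
      gaussSum (complexQuadraticChar K) ψ) ^ 2 = (Fintype.card K : ℂ) ^ (m + 1) := by
  have h1 : (quadraticChar K (-1) : ℂ) ^ 2 = 1 := by
    exact_mod_cast quadraticChar_sq_one (neg_ne_zero.2 (one_ne_zero (α := K)))
  have h2 := quadraticChar_algebraMap_of_odd hK hL hm hcard (-1)
  rw [map_neg, map_one] at h2
  rw [mul_pow, gaussSum_sq (complexQuadraticChar_ne_one hK) (complexQuadraticChar_isQuadratic K) hψ,
    gaussSum_sq (complexQuadraticChar_ne_one hL) (complexQuadraticChar_isQuadratic L)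
      hψ.comp_trace, complexQuadraticChar_apply, complexQuadraticChar_apply, h2, hcard,
    Nat.cast_pow]
  linear_combination (Fintype.card K : ℂ) ^ (m + 1) * h1

/-- The normalized sign governing the number of common zeros of `Tr x` and `Tr (a x²)`. -/
theorem exists_sign_card_trace (hK : ringChar K ≠ 2) (hL : ringChar L ≠ 2) {k : ℕ}
    (hcard : Fintype.card L = Fintype.card K ^ (2 * k + 3)) {ψ : AddChar K ℂ}
    (hψ : ψ.IsPrimitive) :
    ∃ δ : L → ℤ,
      (∀ a, δ a = 0 ∨ δ a = 1 ∨ δ a = -1) ∧ (∀ a, δ a = 0 ↔ Algebra.trace K L a⁻¹ = 0) ∧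
      (∀ a ≠ 0, ((Finset.univ.filter fun x : L =>
          Algebra.trace K L x = 0 ∧ Algebra.trace K L (a * x ^ 2) = 0).card : ℤ) =
        Fintype.card K ^ (2 * k + 1) + (Fintype.card K - 1) * δ a * Fintype.card K ^ k) ∧
      ∑ a, δ a = (Fintype.card K - 1) * Fintype.card K ^ (k + 1) := by
  have hm : Odd (2 * k + 3) := ⟨k + 1, by ring⟩
  set G := gaussSum (complexQuadraticChar L)
        (ψ.compAddMonoidHom (Algebra.trace K L).toAddMonoidHom) with hG
  set g := gaussSum (complexQuadraticChar K) ψ with hg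
  have hq0 : (Fintype.card K : ℂ) ≠ 0 := Nat.cast_ne_zero.2 Fintype.card_ne_zero
  obtain ⟨σ, hσ1, hσ⟩ : ∃ σ : ℤ, (σ = 1 ∨ σ = -1) ∧ G * g = σ * (Fintype.card K : ℂ) ^ (k + 2) := by
    have h := sq_gaussSum_mul_gaussSum hK hL hm hcard hψ
    rw [show 2 * k + 3 + 1 = (k + 2) * 2 by ring, pow_mul, sq_eq_sq_iff_eq_or_eq_neg] at h
    rcases h with h | h
    · exact ⟨1, Or.inl rfl, by rw [h]; simp⟩
    · exact ⟨-1, Or.inr rfl, by rw [h]; simp⟩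
  refine ⟨fun a => σ * (quadraticChar L a * quadraticChar K (-Algebra.trace K L a⁻¹)),
    fun a => ?_, fun a => ?_, fun a ha => ?_, ?_⟩
  · rcases quadraticChar_isQuadratic L a with h | h | h <;>
      rcases quadraticChar_isQuadratic K (-Algebra.trace K L a⁻¹) with h' | h' | h' <;>
      rcases hσ1 with h'' | h'' <;> simp [h, h', h'']
  · have hσ0 : σ ≠ 0 := by rcases hσ1 with h | h <;> simp [h]
    simp only [mul_eq_zero, hσ0, false_or, quadraticChar_eq_zero_iff, neg_eq_zero]
    refine ⟨?_, Or.inr⟩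
    rintro (rfl | h)
    · simp
    · exact h
  · have h := card_trace_eq_zero_and_trace_mul_sq_eq_zero hK hL hm hcard hψ ha
    rw [← hG, ← hg, hσ, hcard] at h
    have h' : ((Finset.univ.filter fun x : L =>
          Algebra.trace K L x = 0 ∧ Algebra.trace K L (a * x ^ 2) = 0).card : ℂ) =
        Fintype.card K ^ (2 * k + 1) + (Fintype.card K - 1) *
        (σ * (quadraticChar L a * quadraticChar K (-Algebra.trace K L a⁻¹))) *
          Fintype.card K ^ k := by
      apply mul_left_cancel₀ (pow_ne_zero 2 hq0)
      rw [h]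
      push_cast
      ring
    exact_mod_cast h'
  · have h := gaussSum_mul_sum_quadraticChar_trace hK hL hm hcard ψ
    have hg2 := gaussSum_sq (complexQuadraticChar_ne_one hK) (complexQuadraticChar_isQuadratic K) hψ
    rw [complexQuadraticChar_apply, ← hg] at hg2
    rw [← hG, ← hg] at h
    have h1 : (quadraticChar K (-1) : ℂ) ^ 2 = 1 := by
      exact_mod_cast quadraticChar_sq_one (neg_ne_zero.2 (one_ne_zero (α := K)))
    have hσ2 : (σ : ℂ) ^ 2 = 1 := by rcases hσ1 with h | h <;> simp [h]
    have hinv : ∑ a : L, (quadraticChar L a : ℂ) * quadraticChar K (-Algebra.trace K L a⁻¹) =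
        ∑ b : L, (quadraticChar L b : ℂ) * quadraticChar K (-Algebra.trace K L b) := by
      rw [← Equiv.sum_comp (Equiv.inv L)]
      refine Finset.sum_congr rfl fun b _ => ?_
      rw [Equiv.inv_apply, inv_inv, quadraticChar_inv]
    rw [← hinv] at h
    rw [← Finset.mul_sum]
    set S := ∑ a : L, (quadraticChar L a : ℂ) * quadraticChar K (-Algebra.trace K L a⁻¹) with hS
    have h' : (σ : ℂ) * S = (Fintype.card K - 1) * Fintype.card K ^ (k + 1) := by
      apply mul_left_cancel₀ hq0
      linear_combination σ * quadraticChar K (-1) * g * h - σ * quadraticChar K (-1) * S * hg2 -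
        σ * (S * Fintype.card K - (Fintype.card K - 1) * (G * g)) * h1 +
        σ * (Fintype.card K - 1) * hσ + (Fintype.card K - 1) * (Fintype.card K : ℂ) ^ (k + 2) * hσ2
    rw [hS] at h'
    exact_mod_cast h'

end TraceCharacter

theorem card_trace_eq_zero_s16 {K L : Type*} [Field K] [Fintype K] [DecidableEq K] [Field L]
    [Fintype L] [Algebra K L] {m : ℕ} (hcard : Fintype.card L = Fintype.card K ^ (m + 1)) :
    (Finset.univ.filter fun x : L => Algebra.trace K L x = 0).card = Fintype.card K ^ m := by
  have hfin : Module.finrank K L = m + 1 := by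
    rw [Module.card_eq_pow_finrank (K := K)] at hcard
    exact Nat.pow_right_injective Fintype.one_lt_card hcard
  have hrank := (Algebra.trace K L).finrank_range_add_finrank_ker
  rw [LinearMap.range_eq_top.2 (Algebra.trace_surjective K L), finrank_top, Module.finrank_self,
    hfin] at hrank
  have hker : Module.finrank K (LinearMap.ker (Algebra.trace K L)) = m := by omega
  have h := Module.natCard_eq_pow_finrank (K := K) (V := LinearMap.ker (Algebra.trace K L))
  rw [hker, Nat.card_eq_fintype_card (α := K)] at h
  rw [← h, ← Fintype.card_subtype, ← Nat.card_eq_fintype_card]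
  exact Nat.card_congr (Equiv.refl _)

theorem codewordWeight_add_card_s16 (p : ℕ) [Fact p.Prime] (F : Type) [Field F] [Fintype F]
    [Algebra (ZMod p) F] {m : ℕ} (hcard : Fintype.card F = p ^ (m + 1)) (a : F) :
    codewordWeight p F a + (Finset.univ.filter fun x : F =>
      Algebra.trace (ZMod p) F x = 0 ∧ Algebra.trace (ZMod p) F (a * x ^ 2) = 0).card = p ^ m := by
  classical
  have hset : {x : F | x ≠ 0 ∧ Algebra.trace (ZMod p) F x = 0 ∧
      Algebra.trace (ZMod p) F (a * x ^ 2) ≠ 0} =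
      ((Finset.univ.filter fun x : F => Algebra.trace (ZMod p) F x = 0).filter fun x =>
        ¬ Algebra.trace (ZMod p) F (a * x ^ 2) = 0 : Finset F) := by
    ext x
    simp only [Set.mem_ofPred_eq, Finset.coe_filter, Finset.mem_filter, Finset.mem_univ, true_and]
    refine ⟨And.right, fun h => ⟨?_, h⟩⟩
    rintro rfl
    simp at h
  rw [codewordWeight, hset, Set.ncard_coe_finset, ← Finset.filter_filter, add_comm,
    Finset.card_filter_add_card_filter_not, card_trace_eq_zero_s16 (m := m) (by rw [hcard, ZMod.card]),
    ZMod.card]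

/-- A function with values in `{0, 1, -1}` takes the values `±1` with multiplicities determined
by its sum and the size of its support. -/
theorem two_mul_card_filter_eq {ι : Type*} [Fintype ι] (δ : ι → ℤ)
    (hδ : ∀ a, δ a = 0 ∨ δ a = 1 ∨ δ a = -1) {ε : ℤ} (hε : ε = 1 ∨ ε = -1) :
    2 * ((Finset.univ.filter fun a => δ a = ε).card : ℤ) =
      (Finset.univ.filter fun a => ¬ δ a = 0).card + ε * ∑ a, δ a := by
  rw [Finset.card_filter, Finset.card_filter]
  push_cast
  rw [Finset.mul_sum, Finset.mul_sum, ← Finset.sum_add_distrib]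
  refine Finset.sum_congr rfl fun a _ => ?_
  rcases hε with rfl | rfl <;> rcases hδ a with h | h | h <;> simp [h]

theorem stmt_16 (p m : ℕ) [Fact p.Prime] (hp2 : p ≠ 2) (hm : 2 ≤ m) (hmodd : Odd m)
    (F : Type) [Field F] [Fintype F] [Algebra (ZMod p) F]
    (hcard : Fintype.card F = p ^ m) :
    ({a : F | a ≠ 0 ∧ codewordWeight p F a = (p - 1) * p ^ (m - 2)}).ncard
        = p ^ (m - 1) - 1 ∧
    2 * ({a : F | a ≠ 0 ∧
          codewordWeight p F a = (p - 1) * (p ^ (m - 2) - p ^ ((m - 3) / 2))}).ncard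
        = (p - 1) * (p ^ (m - 1) + p ^ ((m - 1) / 2)) ∧
    2 * ({a : F | a ≠ 0 ∧
          codewordWeight p F a = (p - 1) * (p ^ (m - 2) + p ^ ((m - 3) / 2))}).ncard
        = (p - 1) * (p ^ (m - 1) - p ^ ((m - 1) / 2)) := by
  classical
  obtain ⟨k, rfl⟩ : ∃ k, m = 2 * k + 3 := by
    obtain ⟨j, rfl⟩ := hmodd
    exact ⟨j - 1, by omega⟩
  have hp : p.Prime := Fact.out
  have hK : ringChar (ZMod p) ≠ 2 := by rwa [ZMod.ringChar_zmod_n]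
  have hL : ringChar F ≠ 2 := by
    rwa [← Algebra.ringChar_eq (ZMod p) F]
  obtain ⟨δ, hδ, hδ0, hN, hsum⟩ := exists_sign_card_trace (K := ZMod p) (L := F) hK hL
    (k := k) (by rw [hcard, ZMod.card]) (ZMod.isPrimitive_stdAddChar p)
  rw [ZMod.card] at hN hsum
  have e1 : 2 * k + 3 - 2 = 2 * k + 1 := by omega
  have e2 : (2 * k + 3 - 3) / 2 = k := by omega
  have e3 : 2 * k + 3 - 1 = 2 * k + 2 := by omega
  have e4 : (2 * k + 2) / 2 = k + 1 := by omega
  rw [e1, e2, e3, e4]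
  have hp1 : (1 : ℤ) < p := by exact_mod_cast hp.one_lt
  have hpk : (0 : ℤ) < (p : ℤ) ^ k := by positivity
  have hle1 : p ^ k ≤ p ^ (2 * k + 1) := Nat.pow_le_pow_right hp.pos (by omega)
  have hle2 : p ^ (k + 1) ≤ p ^ (2 * k + 2) := Nat.pow_le_pow_right hp.pos (by omega)
  have hwt (a : F) (ha : a ≠ 0) : (codewordWeight p F a : ℤ) =
      (p - 1) * (p ^ (2 * k + 1) - δ a * p ^ k) := by
    have h := codewordWeight_add_card_s16 p F (m := 2 * k + 2) hcard a
    zify at h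
    rw [hN a ha] at h
    linear_combination h
  have hwt_iff (a : F) (ha : a ≠ 0) (ε : ℤ) :
      (codewordWeight p F a : ℤ) = (p - 1) * (p ^ (2 * k + 1) - ε * p ^ k) ↔ δ a = ε := by
    rw [hwt a ha, mul_right_inj' (by omega), sub_right_inj, mul_left_inj' hpk.ne']
  have hδzero : δ 0 = 0 := (hδ0 0).2 (by simp)
  have hcard0 : (Finset.univ.filter fun a => δ a = 0).card = p ^ (2 * k + 2) := by
    have h := card_trace_eq_zero_s16 (K := ZMod p) (L := F) (m := 2 * k + 2)
      (by rw [hcard, ZMod.card])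
    rw [ZMod.card] at h
    rw [← h]
    refine Finset.card_equiv (Equiv.inv F) fun a => ?_
    simp [hδ0]
  have hcard1 : ((Finset.univ.filter fun a => ¬ δ a = 0).card : ℤ) =
      (p - 1) * p ^ (2 * k + 2) := by
    have h := Finset.card_filter_add_card_filter_not (s := Finset.univ) fun a => δ a = 0
    rw [hcard0, Finset.card_univ, hcard] at h
    zify at h
    linear_combination h
  have hset (ε : ℤ) (hε : ε ≠ 0) (w : ℕ)
      (hw : (w : ℤ) = (p - 1) * (p ^ (2 * k + 1) - ε * p ^ k)) :
      {a : F | a ≠ 0 ∧ codewordWeight p F a = w} =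
        (Finset.univ.filter fun a => δ a = ε : Finset F) := by
    ext a
    simp only [Set.mem_ofPred_eq, Finset.coe_filter, Finset.mem_univ, true_and]
    constructor
    · rintro ⟨ha, h⟩
      rw [← hwt_iff a ha, ← hw, h]
    · intro h
      have ha : a ≠ 0 := by
        rintro rfl
        exact hε (h.symm.trans hδzero)
      refine ⟨ha, ?_⟩
      have := (hwt_iff a ha ε).2 h
      rw [← hw] at this
      exact_mod_cast this
  refine ⟨?_, ?_, ?_⟩
  · have hset0 : {a : F | a ≠ 0 ∧ codewordWeight p F a = (p - 1) * p ^ (2 * k + 1)} =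
        ((Finset.univ.filter fun a => δ a = 0).erase 0 : Finset F) := by
      ext a
      simp only [Set.mem_ofPred_eq, Finset.mem_coe, Finset.mem_erase, Finset.mem_filter,
        Finset.mem_univ, true_and]
      refine and_congr_right fun ha => ?_
      rw [← hwt_iff a ha, ← Nat.cast_inj (R := ℤ), Nat.cast_mul, Nat.cast_sub hp.one_le]
      simp
    rw [hset0, Set.ncard_coe_finset, Finset.card_erase_of_mem (by simp [hδzero]), hcard0]
  · rw [hset 1 one_ne_zero _ (by
      rw [Nat.cast_mul, Nat.cast_sub hp.one_le, Nat.cast_sub hle1]; push_cast; ring),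
      Set.ncard_coe_finset]
    zify [hp.one_le]
    rw [two_mul_card_filter_eq δ hδ (Or.inl rfl), hcard1, hsum]
    ring
  · rw [hset (-1) (by norm_num) _ (by
      rw [Nat.cast_mul, Nat.cast_sub hp.one_le]; push_cast; ring),
      Set.ncard_coe_finset]
    zify [hp.one_le, hle2]
    rw [two_mul_card_filter_eq δ hδ (Or.inr rfl), hcard1, hsum]
    ring
end
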